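/- Let (X, dist) be a compact metric space, φ : ℝ → X → X a continuous flow (φ₀ = id and φ_{s+t} = φ_s ∘ φ_t), and ν a Borel probability measure on X such that for every x ∈ X and every continuous g : X → ℝ, (1/N)·∑_{a=0}^{N−1} g(φ_a(x)) → ∫_X g dν as N → ∞. Let (qₙ) be a sequence of primes and c₀, δ > 0 with q_{n+1} ≥ c₀·e^{δ·qₙ} for all n, let 0 < d < δ, and set Kₙ = ⌈e^{d·qₙ}⌉ and Nₙ = Kₙ·qₙ. Assume moreover that sup_{x∈X} sup_{0 ≤ K ≤ Kₙ} dist(φ_{K·qₙ}(x), x) → 0 as n → ∞. Then for every x ∈ X and every continuous g : X → ℝ, (1/π(Nₙ)) · ∑_{p prime, p < Nₙ} g(φ_p(x)) → ∫_X g dν as n → ∞; i.e. the orbit sampled at primes below Nₙ is equidistributed with respect to ν along the sequence (Nₙ). -/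

import Mathlib

open Finset in
theorem conv_sum (F a b : ℕ → ℝ) (N : ℕ) :
    ∑ n ∈ Ioc 0 N, F n * ∑ x ∈ n.divisorsAntidiagonal, a x.1 * b x.2 =
      ∑ d ∈ Ioc 0 N, ∑ m ∈ Ioc 0 (N / d), a d * b m * F (d * m) := by
  have h1 : ∀ n ∈ Ioc 0 N, F n * ∑ x ∈ n.divisorsAntidiagonal, a x.1 * b x.2 =
      ∑ x ∈ Ioc 0 N ×ˢ Ioc 0 N with x.1 * x.2 = n, a x.1 * b x.2 * F (x.1 * x.2) := by
    intro n hn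
    simp only [mem_Ioc] at hn
    rw [Nat.divisorsAntidiagonal_eq_prod_filter_of_le hn.1.ne' hn.2, mul_sum]
    refine sum_congr rfl fun x hx => ?_
    rw [(mem_filter.mp hx).2]; ring
  rw [sum_congr rfl h1]
  trans ∑ x ∈ Ioc 0 N ×ˢ Ioc 0 N with x.1 * x.2 ≤ N, a x.1 * b x.2 * F (x.1 * x.2)
  · simp_rw [sum_filter]
    rw [sum_comm]
    exact sum_congr rfl fun _ _ ↦ (by simp_all)
  rw [sum_filter, sum_product]
  refine sum_congr rfl fun n hn ↦ ?_
  rw [← sum_filter]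
  congr 1
  ext m
  simp only [mem_filter, mem_Ioc, and_assoc] at hn ⊢
  rw [Nat.le_div_iff_mul_le hn.1, mul_comm m n]
  constructor
  · rintro ⟨h1, h2, h3⟩; exact ⟨h1, h3⟩
  · rintro ⟨h1, h2⟩; exact ⟨h1, le_trans (Nat.le_mul_of_pos_left m hn.1) h2, h2⟩

open ArithmeticFunction in
noncomputable def Lam2 (n : ℕ) : ℝ :=
  vonMangoldt n * Real.log n +
    ∑ x ∈ n.divisorsAntidiagonal, vonMangoldt x.1 * vonMangoldt x.2

open ArithmeticFunction in
theorem Lam2_nonneg (n : ℕ) : 0 ≤ Lam2 n := by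
  unfold Lam2
  have := Real.log_natCast_nonneg n
  have h2 : 0 ≤ ∑ x ∈ n.divisorsAntidiagonal, vonMangoldt x.1 * vonMangoldt x.2 :=
    Finset.sum_nonneg fun x _ => mul_nonneg vonMangoldt_nonneg vonMangoldt_nonneg
  have h3 := mul_nonneg (vonMangoldt_nonneg (n := n)) this
  linarith

open ArithmeticFunction in
theorem Lam_log_le (n : ℕ) : vonMangoldt n * Real.log n ≤ Lam2 n := by
  unfold Lam2
  have h2 : 0 ≤ ∑ x ∈ n.divisorsAntidiagonal, vonMangoldt x.1 * vonMangoldt x.2 :=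
    Finset.sum_nonneg fun x _ => mul_nonneg vonMangoldt_nonneg vonMangoldt_nonneg
  linarith

open ArithmeticFunction in
theorem Lam2_eq (n : ℕ) :
    Lam2 n = ∑ x ∈ n.divisorsAntidiagonal, ((moebius x.1 : ℤ) : ℝ) * Real.log x.2 ^ 2 := by
  -- arithmetic functions
  let L : ArithmeticFunction ℝ := ArithmeticFunction.log
  have key : ((vonMangoldt.pmul ArithmeticFunction.log) + vonMangoldt * vonMangoldt) *
      (zeta : ArithmeticFunction ℝ) =
      (ArithmeticFunction.log.pmul ArithmeticFunction.log) := by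
    rw [add_mul, mul_assoc, vonMangoldt_mul_zeta]
    ext n
    rcases Nat.eq_zero_or_pos n with rfl | hn
    · simp
    have h1 : (ArithmeticFunction.log.pmul ArithmeticFunction.log) n =
        (∑ x ∈ n.divisorsAntidiagonal, vonMangoldt x.1) * Real.log n := by
      rw [pmul_apply, log_apply, ← vonMangoldt_sum,
        Nat.sum_divisorsAntidiagonal (fun i _ => vonMangoldt i)]
    rw [h1, ArithmeticFunction.add_apply, mul_apply, mul_apply, ← Finset.sum_add_distrib, Finset.sum_mul]
    refine Finset.sum_congr rfl fun x hx => ?_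
    have hx' := Nat.mem_divisorsAntidiagonal.mp hx
    have hx1 : x.1 ≠ 0 := by rintro h; simp [h] at hx'; omega
    have hx2 : x.2 ≠ 0 := by rintro h; simp [h] at hx'; omega
    rw [← hx'.1]
    push_cast
    rw [Real.log_mul (by exact_mod_cast hx1) (by exact_mod_cast hx2)]
    simp [natCoe_apply, zeta_apply, hx2, log_apply]
    ring
  have key2 := congrArg (fun f => (moebius : ArithmeticFunction ℝ) * f) key
  rw [mul_comm _ (zeta : ArithmeticFunction ℝ), ← mul_assoc, coe_moebius_mul_coe_zeta, one_mul] at key2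
  have := congrArg (fun f : ArithmeticFunction ℝ => f n) key2
  simp only [ArithmeticFunction.add_apply, pmul_apply, mul_apply, log_apply, intCoe_apply] at this
  unfold Lam2
  rw [this]
  refine Finset.sum_congr rfl fun x _ => ?_
  ring

open ArithmeticFunction in
theorem log_factorial_eq (N : ℕ) :
    Real.log (N.factorial) = ∑ n ∈ Finset.Ioc 0 N, vonMangoldt n * ((N / n : ℕ) : ℝ) := by
  rw [← sum_Ioc_mul_zeta_eq_sum, vonMangoldt_mul_zeta]
  induction N with
  | zero => simp
  | succ n ih =>
    rw [Nat.factorial_succ, Finset.sum_Ioc_succ_top (Nat.zero_le n)]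
    push_cast
    rw [Real.log_mul (by positivity) (by positivity), ih]
    simp [log_apply, add_comm]

theorem log4_le : Real.log 4 + 4 ≤ 6 := by
  have : Real.log 4 = 2 * Real.log 2 := by
    rw [show (4:ℝ) = 2 ^ 2 by norm_num, Real.log_pow]; norm_num
  have := Real.log_two_lt_d9
  linarith

open ArithmeticFunction in
theorem psi_nat_le (N : ℕ) : ∑ n ∈ Finset.Ioc 0 N, vonMangoldt n ≤ 6 * N := by
  have := Chebyshev.psi_le_const_mul_self (x := N) (by positivity)
  rw [Chebyshev.psi, Nat.floor_natCast] at this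
  have h4 := log4_le
  have : (Real.log 4 + 4) * N ≤ 6 * (N : ℝ) := by gcongr
  linarith

open ArithmeticFunction in
theorem mertens_le (N : ℕ) (hN : 0 < N) :
    ∑ n ∈ Finset.Ioc 0 N, vonMangoldt n / n ≤ Real.log N + 6 := by
  have h1 := log_factorial_eq N
  have h2 : Real.log N.factorial ≤ N * Real.log N := by
    rw [← Real.log_pow]
    apply Real.log_le_log (by positivity)
    exact_mod_cast Nat.factorial_le_pow N
  have h3 : N * ∑ n ∈ Finset.Ioc 0 N, vonMangoldt n / n ≤
      ∑ n ∈ Finset.Ioc 0 N, vonMangoldt n * ((N / n : ℕ) : ℝ) +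
      ∑ n ∈ Finset.Ioc 0 N, vonMangoldt n := by
    rw [Finset.mul_sum, ← Finset.sum_add_distrib]
    refine Finset.sum_le_sum fun n hn => ?_
    have hn' := Finset.mem_Ioc.mp hn
    have h5 : (N : ℝ) / n ≤ ((N / n : ℕ) : ℝ) + 1 := by
      rw [← Nat.floor_div_eq_div (K := ℝ)]
      exact (Nat.lt_floor_add_one _).le
    have := mul_le_mul_of_nonneg_left h5 (vonMangoldt_nonneg (n := n))
    calc N * (vonMangoldt n / n) = vonMangoldt n * (N / n) := by ring
      _ ≤ _ := by linarith
  have h4 := psi_nat_le N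
  have hN' : (0:ℝ) < N := by exact_mod_cast hN
  have : N * ∑ n ∈ Finset.Ioc 0 N, vonMangoldt n / n ≤ N * (Real.log N + 6) := by
    linarith
  exact le_of_mul_le_mul_left this hN'

open ArithmeticFunction in
theorem sum_Lam2_le (N : ℕ) (hN : 0 < N) :
    ∑ n ∈ Finset.Ioc 0 N, Lam2 n ≤ 12 * N * (Real.log N + 6) := by
  unfold Lam2
  rw [Finset.sum_add_distrib]
  have h1 : ∑ n ∈ Finset.Ioc 0 N, vonMangoldt n * Real.log n ≤ 6 * N * Real.log N := by
    calc _ ≤ ∑ n ∈ Finset.Ioc 0 N, vonMangoldt n * Real.log N := by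
          refine Finset.sum_le_sum fun n hn => ?_
          have hn' := Finset.mem_Ioc.mp hn
          refine mul_le_mul_of_nonneg_left ?_ vonMangoldt_nonneg
          apply Real.log_le_log
          · exact_mod_cast hn'.1
          · exact_mod_cast hn'.2
      _ = (∑ n ∈ Finset.Ioc 0 N, vonMangoldt n) * Real.log N := by rw [Finset.sum_mul]
      _ ≤ _ := mul_le_mul_of_nonneg_right (psi_nat_le N) (Real.log_natCast_nonneg N)
  have h2 := conv_sum (fun _ => 1) (fun n => vonMangoldt n) (fun n => vonMangoldt n) N
  simp only [one_mul, mul_one] at h2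
  rw [h2]
  have h3 : ∑ d ∈ Finset.Ioc 0 N, ∑ m ∈ Finset.Ioc 0 (N / d), vonMangoldt d * vonMangoldt m ≤
      ∑ d ∈ Finset.Ioc 0 N, 6 * N * (vonMangoldt d / d) := by
    refine Finset.sum_le_sum fun n hn => ?_
    rw [← Finset.mul_sum]
    have h5 : ((N / n : ℕ) : ℝ) ≤ (N : ℝ) / n := Nat.cast_div_le
    calc _ ≤ vonMangoldt n * (6 * (N / n : ℕ)) :=
          mul_le_mul_of_nonneg_left (psi_nat_le _) vonMangoldt_nonneg
      _ ≤ vonMangoldt n * (6 * (N / n)) :=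
          mul_le_mul_of_nonneg_left (by linarith) vonMangoldt_nonneg
      _ = _ := by ring
  rw [← Finset.mul_sum] at h3
  have h4 := mul_le_mul_of_nonneg_left (mertens_le N hN) (show (0:ℝ) ≤ 6 * N by positivity)
  have : (0:ℝ) ≤ N := by positivity
  linarith

open ArithmeticFunction in
theorem window_choose (x y : ℕ) (hyx : y ≤ x) (hxy : x ≤ 2 * y) :
    ∑ n ∈ Finset.Ioc y x, vonMangoldt n ≤ Real.log (x.choose y) := by
  have hc : (x.choose y : ℝ) * (y.factorial * (x - y).factorial) = x.factorial := by
    rw [← mul_assoc]; exact_mod_cast Nat.choose_mul_factorial_mul_factorial hyx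
  have hc0 : (0:ℝ) < x.choose y := by exact_mod_cast Nat.choose_pos hyx
  have h1 := congrArg Real.log hc
  rw [Real.log_mul hc0.ne' (by positivity), Real.log_mul (by positivity) (by positivity),
    log_factorial_eq, log_factorial_eq, log_factorial_eq] at h1
  have ext : ∀ z : ℕ, z ≤ x → ∑ n ∈ Finset.Ioc 0 z, vonMangoldt n * ((z / n : ℕ) : ℝ) =
      ∑ n ∈ Finset.Ioc 0 x, vonMangoldt n * ((z / n : ℕ) : ℝ) := by
    intro z hz
    apply Finset.sum_subset
    · exact Finset.Ioc_subset_Ioc_right hz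
    · intro n _ hn
      simp only [Finset.mem_Ioc, not_and, not_le] at hn
      rcases Nat.eq_zero_or_pos n with rfl | h0
      · simp
      · rw [Nat.div_eq_of_lt (hn h0)]; simp
  rw [ext y hyx, ext (x - y) (by omega)] at h1
  have h2 : Real.log (x.choose y) = ∑ n ∈ Finset.Ioc 0 x, vonMangoldt n *
      (((x / n : ℕ) : ℝ) - ((y / n : ℕ) : ℝ) - (((x - y) / n : ℕ) : ℝ)) := by
    simp only [mul_sub, Finset.sum_sub_distrib]
    linarith
  rw [h2]
  calc ∑ n ∈ Finset.Ioc y x, vonMangoldt n = ∑ n ∈ Finset.Ioc y x, vonMangoldt n *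
      (((x / n : ℕ) : ℝ) - ((y / n : ℕ) : ℝ) - (((x - y) / n : ℕ) : ℝ)) := by
        refine Finset.sum_congr rfl fun n hn => ?_
        have hn' := Finset.mem_Ioc.mp hn
        rw [Nat.div_eq_of_lt (show y < n by omega), Nat.div_eq_of_lt (show x - y < n by omega),
          show x / n = 1 from Nat.div_eq_of_lt_le (by omega) (by omega)]
        simp
    _ ≤ _ := by
        refine Finset.sum_le_sum_of_subset_of_nonneg
          (Finset.Ioc_subset_Ioc_left (Nat.zero_le y)) fun n hn _ => ?_
        refine mul_nonneg vonMangoldt_nonneg ?_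
        have : y / n + (x - y) / n ≤ x / n := by
          have := Nat.div_add_div_le_add_div (x := y) (y := x - y) (z := n)
          rwa [Nat.add_sub_cancel' hyx] at this
        have : ((y / n : ℕ) : ℝ) + (((x - y) / n : ℕ) : ℝ) ≤ ((x / n : ℕ) : ℝ) := by exact_mod_cast this
        linarith

theorem log_choose_le (x k : ℕ) (t : ℝ) (ht : 0 < t) (hk : k ≤ x) :
    Real.log (x.choose k) ≤ k * Real.log (1 / t) + x * t := by
  have h1 : (x.choose k : ℝ) * t ^ k ≤ (t + 1) ^ x := by
    rw [add_pow]
    calc (x.choose k : ℝ) * t ^ k = t ^ k * 1 ^ (x - k) * x.choose k := by simp; ring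
      _ ≤ _ := Finset.single_le_sum (f := fun m => t ^ m * 1 ^ (x - m) * (x.choose m : ℝ))
        (fun i _ => by positivity) (by simp; omega)
  have hc0 : (0:ℝ) < x.choose k := by exact_mod_cast Nat.choose_pos hk
  have h2 := Real.log_le_log (by positivity) h1
  rw [Real.log_mul hc0.ne' (by positivity), Real.log_pow, Real.log_pow] at h2
  have h3 : Real.log (t + 1) ≤ t := by
    have := Real.log_le_sub_one_of_pos (show 0 < t + 1 by linarith); linarith
  have h4 : x * Real.log (t + 1) ≤ x * t := by gcongr
  rw [one_div, Real.log_inv]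
  linarith

open ArithmeticFunction in
/-- short windows contain few primes -/
theorem window_bound (κ : ℝ) (hκ : 0 < κ) : ∃ η : ℝ, 0 < η ∧ η ≤ 1 / 2 ∧ ∃ y0 : ℝ, 1 ≤ y0 ∧
    ∀ y : ℝ, y0 ≤ y → ∀ x : ℝ, y ≤ x → x ≤ Real.exp η * y →
      ∑ n ∈ Finset.Ioc ⌊y⌋₊ ⌊x⌋₊, vonMangoldt n ≤ κ * y := by
  obtain ⟨t, ht0, ht1, htκ⟩ : ∃ t : ℝ, 0 < t ∧ t < 1 ∧ 2 * t ≤ κ / 2 :=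
    ⟨min (1/2) (κ/4), by positivity, lt_of_le_of_lt (min_le_left _ _) (by norm_num),
      by have := min_le_right (1/2) (κ/4); linarith⟩
  have hl : 0 < Real.log (1 / t) := Real.log_pos (by rw [lt_div_iff₀ ht0]; linarith)
  set l := Real.log (1 / t) with hldef
  obtain ⟨e, he0, he1, hel⟩ : ∃ e : ℝ, 0 < e ∧ e ≤ 1 / 4 ∧ 2 * e * l ≤ κ / 2 :=
    ⟨min (1/4) (κ/(4*l)), by positivity, min_le_left _ _, by
      have := min_le_right (1/4) (κ/(4*l))
      calc 2 * min (1/4) (κ/(4*l)) * l ≤ 2 * (κ/(4*l)) * l := by gcongr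
        _ = κ / 2 := by field_simp; norm_num⟩
  have hexp : Real.exp (Real.log (1 + e)) = 1 + e := Real.exp_log (by linarith)
  refine ⟨Real.log (1 + e), Real.log_pos (by linarith), ?_, max 4 (1 / e), by simp, ?_⟩
  · have := Real.log_le_sub_one_of_pos (show 0 < 1 + e by linarith); linarith
  intro y hy x hyx hxy
  rw [hexp] at hxy
  have hy4 : 4 ≤ y := le_trans (le_max_left _ _) hy
  have hye : 1 ≤ e * y := by
    have := le_trans (le_max_right _ _) hy
    rw [div_le_iff₀ he0] at this; linarith
  have hf : ⌊y⌋₊ ≤ ⌊x⌋₊ := Nat.floor_mono hyx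
  have hfx : (⌊x⌋₊ : ℝ) ≤ x := Nat.floor_le (by linarith)
  have hfy : y < (⌊y⌋₊ : ℝ) + 1 := Nat.lt_floor_add_one y
  have hey : e * y ≤ 1 / 4 * y := by gcongr
  have h2 : ⌊x⌋₊ ≤ 2 * ⌊y⌋₊ := by
    have : (⌊x⌋₊ : ℝ) ≤ 2 * ⌊y⌋₊ := by linarith
    exact_mod_cast this
  refine (window_choose _ _ hf h2).trans ?_
  rw [← Nat.choose_symm hf]
  refine (log_choose_le _ _ t ht0 (Nat.sub_le _ _)).trans ?_
  rw [Nat.cast_sub hf]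
  have h3 : ((⌊x⌋₊ : ℝ) - ⌊y⌋₊) * l ≤ (2 * e * y) * l := by
    gcongr; linarith
  have h4 : (⌊x⌋₊ : ℝ) * t ≤ (2 * y) * t := by gcongr; linarith
  have h5 : 2 * e * l * y ≤ κ / 2 * y := by gcongr
  have h6 : 2 * t * y ≤ κ / 2 * y := by gcongr
  linarith


theorem abel_range (F h S : ℕ → ℝ) (hS : ∀ n, S n = ∑ i ∈ Finset.range n, F i) (n : ℕ) :
    ∑ i ∈ Finset.range n, F i * h i =
      h n * S n - ∑ i ∈ Finset.range n, (h (i + 1) - h i) * S (i + 1) := by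
  induction n with
  | zero => simp [hS]
  | succ n ih =>
    rw [Finset.sum_range_succ, ih, Finset.sum_range_succ]
    have : S (n + 1) = S n + F n := by rw [hS, hS, Finset.sum_range_succ]
    rw [this]; ring

theorem abel_bound (F h : ℕ → ℝ) (B : ℝ) (hm : Monotone h) (h0 : 0 ≤ h 0)
    (hB : ∀ n, |∑ i ∈ Finset.range n, F i| ≤ B) (n : ℕ) :
    |∑ i ∈ Finset.range n, F i * h i| ≤ 2 * B * h n := by
  rw [abel_range F h _ (fun n => rfl) n]
  have hB0 : 0 ≤ B := le_trans (abs_nonneg _) (hB 0)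
  have hn : 0 ≤ h n := h0.trans (hm (Nat.zero_le n))
  have h1 : |h n * ∑ i ∈ Finset.range n, F i| ≤ h n * B := by
    rw [abs_mul, abs_of_nonneg hn]; exact mul_le_mul_of_nonneg_left (hB n) hn
  have h2 : |∑ i ∈ Finset.range n, (h (i + 1) - h i) * ∑ j ∈ Finset.range (i + 1), F j| ≤
      (h n - h 0) * B := by
    calc _ ≤ ∑ i ∈ Finset.range n, |(h (i + 1) - h i) * ∑ j ∈ Finset.range (i + 1), F j| :=
          Finset.abs_sum_le_sum_abs _ _
      _ ≤ ∑ i ∈ Finset.range n, (h (i + 1) - h i) * B := by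
          refine Finset.sum_le_sum fun i _ => ?_
          have : 0 ≤ h (i + 1) - h i := sub_nonneg.mpr (hm (Nat.le_succ i))
          rw [abs_mul, abs_of_nonneg this]
          exact mul_le_mul_of_nonneg_left (hB _) this
      _ = _ := by rw [← Finset.sum_mul, Finset.sum_range_sub]
  have h3 := abs_sub (h n * ∑ i ∈ Finset.range n, F i)
    (∑ i ∈ Finset.range n, (h (i + 1) - h i) * ∑ j ∈ Finset.range (i + 1), F j)
  have h4 : h 0 * B ≥ 0 := mul_nonneg h0 hB0
  nlinarith [h1, h2, h3, h4]

theorem cast_injOn (q : ℕ) [NeZero q] : Set.InjOn (fun m : ℕ => (m : ZMod q)) (Finset.range q) := by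
  intro a ha b hb hab
  simp only [Finset.coe_range, Set.mem_Iio] at ha hb
  have := (ZMod.natCast_eq_natCast_iff' a b q).mp hab
  rwa [Nat.mod_eq_of_lt ha, Nat.mod_eq_of_lt hb] at this

theorem sum_range_q (q : ℕ) [NeZero q] (g : ZMod q → ℝ) :
    ∑ m ∈ Finset.range q, g (m : ZMod q) = ∑ v, g v := by
  refine Finset.sum_nbij (fun m : ℕ => (m : ZMod q)) (fun _ _ => Finset.mem_univ _)
    (cast_injOn q) ?_ (fun _ _ => rfl)
  intro v _
  exact ⟨v.val, by simpa using ZMod.val_lt v, by simp⟩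

theorem sum_range_lt (q : ℕ) [NeZero q] (g : ZMod q → ℝ) (hg : ∀ v, 0 ≤ g v) (r : ℕ) (hr : r ≤ q) :
    ∑ m ∈ Finset.range r, g (m : ZMod q) ≤ ∑ v, g v := by
  rw [← sum_range_q]
  exact Finset.sum_le_sum_of_subset_of_nonneg (Finset.range_mono hr) fun _ _ _ => hg _

theorem sum_range_period (q : ℕ) [NeZero q] (g : ZMod q → ℝ) (a r : ℕ) :
    ∑ m ∈ Finset.range (q * a + r), g (m : ZMod q) =
      a * ∑ v, g v + ∑ m ∈ Finset.range r, g (m : ZMod q) := by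
  induction a with
  | zero => simp
  | succ a ih =>
    rw [show q * (a + 1) + r = q + (q * a + r) by ring, Finset.sum_range_add]
    simp only [Nat.cast_add, CharP.cast_eq_zero, zero_add]
    rw [sum_range_q]
    rw [ih]; push_cast; ring

theorem sum_range_abs (q : ℕ) [NeZero q] (g : ZMod q → ℝ) (hg : ∑ v, g v = 0) (n : ℕ) :
    |∑ m ∈ Finset.range n, g (m : ZMod q)| ≤ ∑ v, |g v| := by
  conv_lhs => rw [← Nat.div_add_mod n q]
  rw [sum_range_period, hg, mul_zero, zero_add]
  refine (Finset.abs_sum_le_sum_abs _ _).trans ?_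
  exact sum_range_lt q (fun v => |g v|) (fun _ => abs_nonneg _) _
    (Nat.mod_lt _ (Nat.pos_of_ne_zero (NeZero.ne q))).le

theorem sum_range_count (q : ℕ) [NeZero q] (g : ZMod q → ℝ) (hg : ∀ v, 0 ≤ g v) (n : ℕ) :
    ∑ m ∈ Finset.range n, g (m : ZMod q) ≤ ((n / q : ℕ) + 1) * ∑ v, g v := by
  conv_lhs => rw [← Nat.div_add_mod n q]
  rw [sum_range_period]
  have := sum_range_lt q g hg (n % q) (Nat.mod_lt _ (Nat.pos_of_ne_zero (NeZero.ne q))).le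
  linarith

theorem sum_Ioc_range (F : ℕ → ℝ) (h0 : F 0 = 0) (n : ℕ) :
    ∑ m ∈ Finset.Ioc 0 n, F m = ∑ m ∈ Finset.range (n + 1), F m := by
  rw [Finset.sum_range_succ', h0, add_zero]
  induction n with
  | zero => simp
  | succ n ih => rw [Finset.sum_Ioc_succ_top (Nat.zero_le n), ih, Finset.sum_range_succ]

theorem sum_mul_unit (q : ℕ) [Fact q.Prime] (g : ZMod q → ℝ) (c : ZMod q) (hc : c ≠ 0) :
    ∑ v, g (c * v) = ∑ v, g v :=
  Equiv.sum_comp (Equiv.mulLeft₀ c hc) g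

theorem sum_inv_sqrt (D : ℕ) : ∑ d ∈ Finset.Ioc 0 D, 1 / Real.sqrt d ≤ 2 * Real.sqrt D := by
  induction D with
  | zero => simp
  | succ n ih =>
    rw [Finset.sum_Ioc_succ_top (Nat.zero_le n)]
    have h1 : 0 < Real.sqrt ((n + 1 : ℕ) : ℝ) := Real.sqrt_pos.mpr (by positivity)
    have h2 : 0 ≤ Real.sqrt (n : ℝ) := Real.sqrt_nonneg _
    have h3 : Real.sqrt ((n + 1 : ℕ) : ℝ) ^ 2 = n + 1 := by rw [Real.sq_sqrt (by positivity)]; push_cast; ring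
    have h4 : Real.sqrt (n : ℝ) ^ 2 = n := Real.sq_sqrt (by positivity)
    have : 1 / Real.sqrt ((n + 1 : ℕ) : ℝ) ≤ 2 * Real.sqrt ((n + 1 : ℕ) : ℝ) - 2 * Real.sqrt n := by
      rw [div_le_iff₀ h1]
      nlinarith [sq_nonneg (Real.sqrt ((n + 1 : ℕ) : ℝ) - Real.sqrt n)]
    linarith

theorem log_sq_le (y : ℝ) (hy : 1 ≤ y) : Real.log y ^ 2 ≤ 16 * Real.sqrt y := by
  have h1 : Real.log y ≤ y ^ (1/4 : ℝ) / (1/4) := Real.log_le_rpow_div (by linarith) (by norm_num)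
  have h2 : (y ^ (1/4 : ℝ)) ^ 2 = Real.sqrt y := by
    rw [← Real.rpow_natCast, ← Real.rpow_mul (by linarith), Real.sqrt_eq_rpow]; norm_num
  have h3 : 0 ≤ Real.log y := Real.log_nonneg hy
  calc Real.log y ^ 2 ≤ (y ^ (1/4 : ℝ) / (1/4)) ^ 2 := by gcongr
    _ = 16 * (y ^ (1/4 : ℝ)) ^ 2 := by ring
    _ = _ := by rw [h2]

theorem log_cube_le (y : ℝ) (hy : 1 ≤ y) :
    Real.log y ^ 2 * (3 + Real.log y) ≤ 324 * Real.sqrt y := by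
  have h1 : Real.log y ≤ y ^ (1/6 : ℝ) / (1/6) := Real.log_le_rpow_div (by linarith) (by norm_num)
  have h2 : (y ^ (1/6 : ℝ)) ^ 3 = Real.sqrt y := by
    rw [← Real.rpow_natCast, ← Real.rpow_mul (by linarith), Real.sqrt_eq_rpow]; norm_num
  have h3 : 0 ≤ Real.log y := Real.log_nonneg hy
  have h4 : 1 ≤ y ^ (1/6 : ℝ) := Real.one_le_rpow hy (by norm_num)
  rw [← h2]
  set s := y ^ (1/6 : ℝ)
  calc Real.log y ^ 2 * (3 + Real.log y) ≤ (s / (1/6)) ^ 2 * (3 * s + s / (1/6)) := by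
        gcongr; linarith
    _ = 324 * s ^ 3 := by ring

theorem log_sq_mono : Monotone (fun m : ℕ => Real.log m ^ 2) := by
  intro a b hab
  simp only
  have ha := Real.log_natCast_nonneg a
  rcases Nat.eq_zero_or_pos a with rfl | h
  · simp; positivity
  have : Real.log a ≤ Real.log b := Real.log_le_log (by exact_mod_cast h) (by exact_mod_cast hab)
  gcongr

open ArithmeticFunction in
theorem typeI (q : ℕ) [hq : Fact q.Prime] (f : ZMod q → ℝ) (f0 : f 0 = 0) (fs : ∑ v, f v = 0)
    (N : ℕ) (hN : q ^ 2 ≤ N) :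
    |∑ n ∈ Finset.Ioc 0 N, f (n : ZMod q) * Lam2 n| ≤ 420 * (∑ v, |f v|) * (N / Real.sqrt q) := by
  set A := ∑ v, |f v| with hA
  have hA0 : 0 ≤ A := Finset.sum_nonneg fun _ _ => abs_nonneg _
  have hq1 : 2 ≤ q := hq.out.two_le
  have hqR : (0:ℝ) < q := by positivity
  have hN0 : 0 < N := lt_of_lt_of_le (by positivity) hN
  simp_rw [Lam2_eq]
  rw [conv_sum (fun n => f (n : ZMod q)) (fun d => ((moebius d : ℤ) : ℝ)) (fun m => Real.log m ^ 2)]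
  have hmu : ∀ d : ℕ, |((moebius d : ℤ) : ℝ)| ≤ 1 := fun d => by
    have := abs_moebius_le_one (n := d)
    exact_mod_cast this
  set D := N / q with hD
  have hDN : D ≤ N := Nat.div_le_self _ _
  -- single d
  have hunit : ∀ d : ℕ, ((d : ZMod q) ≠ 0) → ∀ (g : ZMod q → ℝ),
      ∑ v, g ((d : ZMod q) * v) = ∑ v, g v := fun d hd g => sum_mul_unit q g _ hd
  have part1 : ∀ d ∈ Finset.Ioc 0 D,
      |∑ m ∈ Finset.Ioc 0 (N / d), ((moebius d : ℤ) : ℝ) * Real.log m ^ 2 * f ((d * m : ℕ) : ZMod q)|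
        ≤ 48 * A * Real.sqrt N * (1 / Real.sqrt d) := by
    intro d hd
    have hd' := Finset.mem_Ioc.mp hd
    have hdR : (0:ℝ) < d := by exact_mod_cast hd'.1
    have hdN : d ≤ N := hd'.2.trans hDN
    by_cases hdq : (d : ZMod q) = 0
    · simp only [Nat.cast_mul, hdq, zero_mul, f0, mul_zero, Finset.sum_const_zero, abs_zero]
      positivity
    have e1 : ∑ m ∈ Finset.Ioc 0 (N / d), ((moebius d : ℤ) : ℝ) * Real.log m ^ 2 *
        f ((d * m : ℕ) : ZMod q) = ((moebius d : ℤ) : ℝ) *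
        ∑ m ∈ Finset.range (N / d + 1), f ((d : ZMod q) * (m : ZMod q)) * Real.log m ^ 2 := by
      rw [← sum_Ioc_range _ (by simp), Finset.mul_sum]
      refine Finset.sum_congr rfl fun m _ => ?_
      push_cast; ring
    rw [e1, abs_mul]
    have b1 := abel_bound (fun m : ℕ => f ((d : ZMod q) * (m : ZMod q))) (fun m => Real.log m ^ 2) A
      log_sq_mono (by simp) (fun n => by
        have := sum_range_abs q (fun v => f ((d : ZMod q) * v)) (by rw [hunit d hdq, fs]) n
        rwa [hunit d hdq (fun v => |f v|)] at this) (N / d + 1)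
    have b2 : Real.log ((N / d + 1 : ℕ) : ℝ) ^ 2 ≤ 24 * (Real.sqrt N * (1 / Real.sqrt d)) := by
      have c1 : ((N / d + 1 : ℕ) : ℝ) ≤ 2 * ((N : ℝ) / d) := by
        push_cast
        have : ((N / d : ℕ) : ℝ) ≤ (N : ℝ) / d := Nat.cast_div_le
        have h1 : 1 ≤ (N : ℝ) / d := by rw [le_div_iff₀ hdR]; simpa using (by exact_mod_cast hdN)
        linarith
      refine (log_sq_le _ (by push_cast; linarith [Nat.cast_nonneg (α := ℝ) (N / d)])).trans ?_
      have c2 : Real.sqrt ((N / d + 1 : ℕ) : ℝ) ≤ Real.sqrt 2 * (Real.sqrt N * (1 / Real.sqrt d)) := by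
        refine (Real.sqrt_le_sqrt c1).trans (le_of_eq ?_)
        rw [Real.sqrt_mul (by norm_num), Real.sqrt_div (by positivity)]; ring
      have c3 : Real.sqrt 2 ≤ 3 / 2 := by
        rw [Real.sqrt_le_left (by norm_num)]; norm_num
      have c4 : 0 ≤ Real.sqrt N * (1 / Real.sqrt d) := by positivity
      nlinarith
    calc _ ≤ 1 * (2 * A * Real.log ((N / d + 1 : ℕ) : ℝ) ^ 2) :=
          mul_le_mul (hmu d) b1 (abs_nonneg _) (by norm_num)
      _ ≤ 1 * (2 * A * (24 * (Real.sqrt N * (1 / Real.sqrt d)))) := by gcongr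
      _ = _ := by ring
  have part2 : ∑ d ∈ Finset.Ioc D N, |∑ m ∈ Finset.Ioc 0 (N / d),
      ((moebius d : ℤ) : ℝ) * Real.log m ^ 2 * f ((d * m : ℕ) : ZMod q)| ≤
      A * (Real.log q ^ 2 * (3 + Real.log q)) * (N / q) := by
    calc _ ≤ ∑ d ∈ Finset.Ioc D N, ∑ m ∈ Finset.Ioc 0 (N / d),
          Real.log q ^ 2 * |f ((d : ZMod q) * (m : ZMod q))| := by
          refine Finset.sum_le_sum fun d hd => (Finset.abs_sum_le_sum_abs _ _).trans ?_
          refine Finset.sum_le_sum fun m hm => ?_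
          have hd' := Finset.mem_Ioc.mp hd
          have hm' := Finset.mem_Ioc.mp hm
          have hmq : m ≤ q := by
            have h1 : N < q * (D + 1) := Nat.lt_mul_div_succ N (by omega)
            have h2 : N / d < q := (Nat.div_lt_iff_lt_mul ((Nat.zero_le D).trans_lt hd'.1)).mpr
              (lt_of_lt_of_le h1 (Nat.mul_le_mul_left q hd'.1))
            omega
          rw [abs_mul, abs_mul, abs_of_nonneg (sq_nonneg (Real.log (m:ℝ)))]
          push_cast
          have := log_sq_mono hmq
          simp only at this
          calc _ ≤ 1 * Real.log q ^ 2 * |f ((d : ZMod q) * (m : ZMod q))| := by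
                gcongr; exact hmu d
            _ = _ := by ring
      _ ≤ ∑ m ∈ Finset.Ioc 0 (q - 1), ∑ d ∈ Finset.Ioc 0 (N / m),
          Real.log q ^ 2 * |f ((d : ZMod q) * (m : ZMod q))| := by
          rw [Finset.sum_sigma', Finset.sum_sigma']
          rw [Finset.sum_nbij (s := (Finset.Ioc D N).sigma fun d => Finset.Ioc 0 (N / d))
            (t := ((Finset.Ioc D N).sigma fun d => Finset.Ioc 0 (N / d)).image
              (fun x => (⟨x.2, x.1⟩ : Σ _ : ℕ, ℕ)))
            (f := fun x => Real.log q ^ 2 * |f ((x.1 : ZMod q) * (x.2 : ZMod q))|)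
            (g := fun x => Real.log q ^ 2 * |f ((x.2 : ZMod q) * (x.1 : ZMod q))|)
            (fun x => (⟨x.2, x.1⟩ : Σ _ : ℕ, ℕ))
            (fun x hx => Finset.mem_image_of_mem _ hx)
            (by rintro ⟨a, b⟩ _ ⟨c, d⟩ _ h; simp at h; simp [h])
            (by simp [Set.SurjOn]) (fun _ _ => rfl)]
          refine Finset.sum_le_sum_of_subset_of_nonneg ?_ fun _ _ _ => by positivity
          rintro ⟨m, d⟩ hx
          simp only [Finset.mem_image, Finset.mem_sigma, Finset.mem_Ioc] at hx
          obtain ⟨⟨d', m'⟩, ⟨⟨h1, h2⟩, h3, h4⟩, h5⟩ := hx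
          simp only [Sigma.mk.injEq, heq_eq_eq] at h5 h1 h2 h3 h4
          obtain ⟨rfl, rfl⟩ := h5
          have h6 : N < q * (D + 1) := Nat.lt_mul_div_succ N (by omega)
          have hd0 : 0 < d' := (Nat.zero_le D).trans_lt h1
          have h7 : N / d' < q := (Nat.div_lt_iff_lt_mul hd0).mpr
              (lt_of_lt_of_le h6 (Nat.mul_le_mul_left q h1))
          have h8 := (Nat.le_div_iff_mul_le hd0).mp h4
          simp only [Finset.mem_sigma, Finset.mem_Ioc]
          refine ⟨⟨h3, by omega⟩, hd0, (Nat.le_div_iff_mul_le h3).mpr (by linarith)⟩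
      _ ≤ ∑ m ∈ Finset.Ioc 0 (q - 1), Real.log q ^ 2 * (A * (N / q * (1 / (m:ℝ)) + 2)) := by
          refine Finset.sum_le_sum fun m hm => ?_
          have hm' := Finset.mem_Ioc.mp hm
          rw [← Finset.mul_sum]
          refine mul_le_mul_of_nonneg_left ?_ (sq_nonneg _)
          have hm0 : (m : ZMod q) ≠ 0 := by
            intro h
            rw [ZMod.natCast_eq_zero_iff] at h
            have := Nat.le_of_dvd hm'.1 h
            omega
          rw [sum_Ioc_range (fun d : ℕ => |f ((d : ZMod q) * (m : ZMod q))|) (by simp [f0])]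
          have c1 := sum_range_count q (fun v => |f (v * (m : ZMod q))|) (fun _ => abs_nonneg _)
            (N / m + 1)
          have c2 : ∑ v, |f (v * (m : ZMod q))| = A := by
            rw [hA, ← hunit m hm0 (fun v => |f v|)]
            simp_rw [mul_comm]
          rw [c2] at c1
          refine c1.trans ?_
          rw [mul_comm]
          refine mul_le_mul_of_nonneg_left ?_ hA0
          have c3 : (N / m + 1) / q ≤ N / m / q + 1 := by
            rw [← Nat.add_div_right _ (by omega : 0 < q)]
            exact Nat.div_le_div_right (by omega)
          have c4 : (((N / m + 1) / q : ℕ) : ℝ) ≤ ((N / m / q : ℕ) : ℝ) + 1 := by exact_mod_cast c3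
          have c5 : ((N / m / q : ℕ) : ℝ) ≤ ((N / m : ℕ) : ℝ) / q := Nat.cast_div_le
          have c6 : ((N / m : ℕ) : ℝ) ≤ (N : ℝ) / m := Nat.cast_div_le
          have c7 : ((N / m : ℕ) : ℝ) / q ≤ (N : ℝ) / m / q := by gcongr
          have c8 : (N : ℝ) / m / q = N / q * (1 / (m:ℝ)) := by ring
          linarith
      _ = A * Real.log q ^ 2 * (N / q * ∑ m ∈ Finset.Ioc 0 (q - 1), 1 / (m:ℝ) + 2 * (q - 1 : ℕ)) := by
          rw [← Finset.mul_sum, ← Finset.mul_sum, Finset.sum_add_distrib, ← Finset.mul_sum]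
          simp; ring
      _ ≤ A * Real.log q ^ 2 * (N / q * (1 + Real.log q) + 2 * (N / q)) := by
          have e1 : ∑ m ∈ Finset.Ioc 0 (q - 1), 1 / (m:ℝ) ≤ 1 + Real.log q := by
            have := harmonic_le_one_add_log (q - 1)
            rw [harmonic_eq_sum_Icc] at this
            push_cast at this
            have h2 : Finset.Ioc 0 (q - 1) = Finset.Icc 1 (q - 1) := rfl
            rw [h2]
            simp only [one_div]
            refine this.trans ?_
            gcongr
            · have : 0 < q - 1 := by omega
              exact_mod_cast this
            · exact_mod_cast Nat.sub_le _ _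
          have e2 : ((q - 1 : ℕ) : ℝ) ≤ N / q := by
            rw [le_div_iff₀ hqR]
            have : (q - 1) * q ≤ N := by nlinarith [Nat.sub_le q 1]
            exact_mod_cast this
          gcongr
      _ = _ := by ring
  have split : Finset.Ioc 0 N = Finset.Ioc 0 D ∪ Finset.Ioc D N :=
    (Finset.Ioc_union_Ioc_eq_Ioc (Nat.zero_le D) hDN).symm
  have hdis : Disjoint (Finset.Ioc 0 D) (Finset.Ioc D N) :=
    Finset.Ioc_disjoint_Ioc_of_le le_rfl
  refine (Finset.abs_sum_le_sum_abs _ _).trans ?_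
  rw [split, Finset.sum_union hdis]
  have p1 := Finset.sum_le_sum part1
  rw [← Finset.mul_sum] at p1
  have p1' : 48 * A * Real.sqrt N * ∑ d ∈ Finset.Ioc 0 D, 1 / Real.sqrt d ≤
      96 * A * (N / Real.sqrt q) := by
    have h1 := sum_inv_sqrt D
    have h2 : Real.sqrt D ≤ Real.sqrt N / Real.sqrt q := by
      rw [← Real.sqrt_div (by positivity)]
      exact Real.sqrt_le_sqrt Nat.cast_div_le
    calc _ ≤ 48 * A * Real.sqrt N * (2 * (Real.sqrt N / Real.sqrt q)) := by gcongr; linarith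
      _ = 96 * A * ((Real.sqrt N * Real.sqrt N) / Real.sqrt q) := by ring
      _ = _ := by rw [Real.mul_self_sqrt (by positivity)]
  have p2 : A * (Real.log q ^ 2 * (3 + Real.log q)) * (N / q) ≤ 324 * A * (N / Real.sqrt q) := by
    have h1 := log_cube_le q (by exact_mod_cast hq.out.one_lt.le)
    calc _ ≤ A * (324 * Real.sqrt q) * (N / q) := by gcongr
      _ = 324 * A * (N * (Real.sqrt q / q)) := by ring
      _ = _ := by rw [Real.sqrt_div_self]; ring
  linarith


theorem bt_diff (q : ℕ) [hq : Fact q.Prime] (N : ℕ) (hN : q ^ 2 ≤ N) (u u' : ZMod q)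
    (hu : u ≠ 0) (hu' : u' ≠ 0) :
    ∑ n ∈ Finset.Ioc 0 N, (if (n : ZMod q) = u then Lam2 n else 0) ≤
      ∑ n ∈ Finset.Ioc 0 N, (if (n : ZMod q) = u' then Lam2 n else 0) + 840 * (N / Real.sqrt q) := by
  have h := typeI q (fun v => (if v = u then 1 else 0) - (if v = u' then 1 else 0))
    (by simp [hu.symm, hu'.symm]) (by simp) N hN
  have h2 : ∑ v : ZMod q, |(if v = u then (1:ℝ) else 0) - (if v = u' then 1 else 0)| ≤ 2 := by
    calc _ ≤ ∑ v : ZMod q, ((if v = u then (1:ℝ) else 0) + (if v = u' then 1 else 0)) := by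
          refine Finset.sum_le_sum fun v _ => ?_
          split_ifs <;> norm_num
      _ = 2 := by rw [Finset.sum_add_distrib]; simp; norm_num
  have h3 := le_of_abs_le h
  have h4 : ∑ n ∈ Finset.Ioc 0 N, ((if (n : ZMod q) = u then (1:ℝ) else 0) -
      (if (n : ZMod q) = u' then 1 else 0)) * Lam2 n =
      ∑ n ∈ Finset.Ioc 0 N, (if (n : ZMod q) = u then Lam2 n else 0) -
      ∑ n ∈ Finset.Ioc 0 N, (if (n : ZMod q) = u' then Lam2 n else 0) := by
    rw [← Finset.sum_sub_distrib]
    refine Finset.sum_congr rfl fun n _ => ?_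
    split_ifs <;> ring
  rw [h4] at h3
  have h5 : 420 * (∑ v : ZMod q, |(if v = u then (1:ℝ) else 0) - (if v = u' then 1 else 0)|) *
      (N / Real.sqrt q) ≤ 420 * 2 * (N / Real.sqrt q) := by gcongr
  linarith

theorem bt_Lam2 (q : ℕ) [hq : Fact q.Prime] (N : ℕ) (hN : q ^ 2 ≤ N)
    (hl : Real.sqrt q ≤ Real.log N) (u : ZMod q) (hu : u ≠ 0) :
    ∑ n ∈ Finset.Ioc 0 N, (if (n : ZMod q) = u then Lam2 n else 0) ≤
      1008 * (N * Real.log N / q) := by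
  have hq2 : (2:ℝ) ≤ q := by exact_mod_cast hq.out.two_le
  have hN0 : 0 < N := lt_of_lt_of_le (pow_pos hq.out.pos 2) hN
  set S : ZMod q → ℝ := fun u => ∑ n ∈ Finset.Ioc 0 N, (if (n : ZMod q) = u then Lam2 n else 0)
    with hS
  have h1 : ∑ u' ∈ Finset.univ.erase (0 : ZMod q), S u ≤
      ∑ u' ∈ Finset.univ.erase (0 : ZMod q), (S u' + 840 * (N / Real.sqrt q)) :=
    Finset.sum_le_sum fun u' hu' => bt_diff q N hN u u' hu (Finset.ne_of_mem_erase hu')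
  rw [Finset.sum_add_distrib, Finset.sum_const, Finset.sum_const,
    Finset.card_erase_of_mem (Finset.mem_univ _), Finset.card_univ, ZMod.card, nsmul_eq_mul,
    nsmul_eq_mul, Nat.cast_sub hq.out.one_lt.le] at h1
  have hS0 : ∀ u, 0 ≤ S u := fun u => Finset.sum_nonneg fun n _ => by
    split_ifs
    · exact Lam2_nonneg n
    · exact le_rfl
  have h2 : ∑ u' ∈ Finset.univ.erase (0 : ZMod q), S u' ≤ 12 * N * (Real.log N + 6) := by
    calc _ ≤ ∑ u', S u' :=
          Finset.sum_le_sum_of_subset_of_nonneg (Finset.erase_subset _ _) fun _ _ _ => hS0 _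
      _ = ∑ n ∈ Finset.Ioc 0 N, Lam2 n := by rw [hS, Finset.sum_comm]; simp
      _ ≤ _ := sum_Lam2_le N hN0
  have hsq : 1 ≤ Real.sqrt q := Real.one_le_sqrt.mpr (by linarith)
  set L := Real.log N
  have h3 : (840 : ℝ) * (N / Real.sqrt q) ≤ 840 * (N * L / q) := by
    have : (N : ℝ) / Real.sqrt q = N * Real.sqrt q / q := by
      rw [mul_div_assoc, Real.sqrt_div_self]; ring
    rw [this]; gcongr
  have h4 : (12 : ℝ) * N * (L + 6) ≤ 84 * N * L := by
    have : (0:ℝ) ≤ N := by positivity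
    nlinarith
  push_cast at h1
  have h5 : ((q:ℝ) - 1) * S u ≤ ((q:ℝ) - 1) * (1008 * (N * L / q)) := by
    have h6 : ((q:ℝ) - 1) * (840 * (N / Real.sqrt q)) ≤ ((q:ℝ) - 1) * (840 * (N * L / q)) := by
      apply mul_le_mul_of_nonneg_left h3; linarith
    have h7 : 84 * N * L ≤ ((q:ℝ) - 1) * (168 * (N * L / q)) := by
      have : ((q:ℝ) - 1) * (168 * (N * L / q)) = 84 * (N * L) * (2 * (q - 1) / q) := by ring
      rw [this]
      have h8 : 1 ≤ 2 * ((q:ℝ) - 1) / q := by rw [le_div_iff₀ (by linarith)]; linarith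
      have : 0 ≤ 84 * (N * L) := by positivity
      nlinarith
    linarith
  exact le_of_mul_le_mul_left h5 (by linarith)

open ArithmeticFunction in
theorem bt (q : ℕ) [hq : Fact q.Prime] (N : ℕ) (hN : q ^ 2 ≤ N)
    (hl : Real.sqrt q ≤ Real.log N) (u : ZMod q) (hu : u ≠ 0) :
    ∑ n ∈ Finset.Ioc 0 N, (if (n : ZMod q) = u then vonMangoldt n else 0) ≤
      2340 * (N / q) := by
  have hq2 : (2:ℝ) ≤ q := by exact_mod_cast hq.out.two_le
  have hN0 : 0 < N := lt_of_lt_of_le (pow_pos hq.out.pos 2) hN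
  have hN1 : (1:ℝ) ≤ N := by exact_mod_cast hN0
  have hsq : 1 ≤ Real.sqrt q := Real.one_le_sqrt.mpr (by linarith)
  have h1 := bt_Lam2 q N hN hl u hu
  set L := Real.log N with hL
  have hL1 : 1 ≤ L := hsq.trans hl
  have hterm : ∀ n ∈ Finset.Ioc 0 N, (if (n : ZMod q) = u then vonMangoldt n else 0) ≤
      (if n ≤ Nat.sqrt N then L else 0) +
        2 / L * (if (n : ZMod q) = u then Lam2 n else 0) := by
    intro n hn
    have hn' := Finset.mem_Ioc.mp hn
    have hnn : 0 ≤ Lam2 n := Lam2_nonneg n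
    have hlog : Real.log n ≤ L := Real.log_le_log (by exact_mod_cast hn'.1) (by exact_mod_cast hn'.2)
    have hv := vonMangoldt_le_log (n := n)
    have hv0 := vonMangoldt_nonneg (n := n)
    have h2L : 0 ≤ 2 / L := by positivity
    by_cases hc : (n : ZMod q) = u
    · simp only [hc, if_true]
      by_cases hs : n ≤ Nat.sqrt N
      · simp only [hs, if_true]
        have := mul_nonneg h2L hnn
        linarith
      · simp only [hs, if_false, zero_add]
        have h2 : N < n * n := by
          have := Nat.sqrt_lt.mp (not_le.mp hs); exact this
        have h3 : L ≤ 2 * Real.log n := by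
          have : Real.log N ≤ Real.log ((n * n : ℕ) : ℝ) :=
            Real.log_le_log (by positivity) (by exact_mod_cast h2.le)
          rw [Nat.cast_mul, Real.log_mul (by have := hn'.1; positivity) (by have := hn'.1; positivity)] at this
          linarith
        have h4 := Lam_log_le n
        rw [div_mul_eq_mul_div, le_div_iff₀ (by linarith)]
        nlinarith
    · simp only [hc, if_false, mul_zero, add_zero]
      split_ifs
      · linarith
      · exact le_rfl
  refine (Finset.sum_le_sum hterm).trans ?_
  rw [Finset.sum_add_distrib, ← Finset.mul_sum]
  have h2 : ∑ n ∈ Finset.Ioc 0 N, (if n ≤ Nat.sqrt N then L else 0) ≤ Real.sqrt N * L := by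
    rw [← Finset.sum_filter, Finset.sum_const, nsmul_eq_mul]
    gcongr
    calc ((Finset.filter (fun n => n ≤ Nat.sqrt N) (Finset.Ioc 0 N)).card : ℝ)
        ≤ ((Finset.Ioc 0 (Nat.sqrt N)).card : ℝ) := by
          norm_cast
          apply Finset.card_le_card
          intro n hn
          simp only [Finset.mem_filter, Finset.mem_Ioc] at hn ⊢
          exact ⟨hn.1.1, hn.2⟩
      _ = (Nat.sqrt N : ℝ) := by simp
      _ ≤ _ := Real.nat_sqrt_le_real_sqrt
  have h3 : Real.sqrt N * L ≤ 324 * (N / q) := by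
    have h4 := log_cube_le N hN1
    rw [← hL] at h4
    have h5 : (q:ℝ) ≤ L ^ 2 := by
      calc (q:ℝ) = Real.sqrt q ^ 2 := (Real.sq_sqrt (by positivity)).symm
        _ ≤ L ^ 2 := by gcongr
    rw [← mul_div_assoc, le_div_iff₀ (by linarith)]
    have h6 : L * q ≤ 324 * Real.sqrt N := by
      have : L * q ≤ L * L ^ 2 := by gcongr
      have : L ^ 2 * 3 ≥ 0 := by positivity
      nlinarith
    calc Real.sqrt N * L * q = Real.sqrt N * (L * q) := by ring
      _ ≤ Real.sqrt N * (324 * Real.sqrt N) := by gcongr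
      _ = 324 * (Real.sqrt N * Real.sqrt N) := by ring
      _ = 324 * N := by rw [Real.mul_self_sqrt (by positivity)]
  have h4 : 2 / L * ∑ n ∈ Finset.Ioc 0 N, (if (n : ZMod q) = u then Lam2 n else 0) ≤
      2016 * (N / q) := by
    calc _ ≤ 2 / L * (1008 * (N * L / q)) := by gcongr
      _ = _ := by field_simp; norm_num
  linarith


theorem tII_var (q : ℕ) [hq : Fact q.Prime] (b : ZMod q → ℝ) (B : ℝ) (K : ℕ) (hK : K ≤ q)
    (s : ZMod q) (hs : s ≠ 0) (hb : ∀ v, |b v| ≤ B) (hb0 : ∑ v, b v = 0) :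
    ∑ u ∈ Finset.univ.erase (0 : ZMod q), ∑ v,
      (∑ k ∈ Finset.range K, b (u⁻¹ * (v - k * s))) ^ 2 ≤ K * (q ^ 2 * B ^ 2) := by
  have hB : ∀ v, b v ^ 2 ≤ B ^ 2 := fun v => by
    rw [← sq_abs]; have := abs_nonneg (b v); gcongr; exact hb v
  have hpair : ∀ k ∈ Finset.range K, ∀ k' ∈ Finset.range K,
      ∑ u ∈ Finset.univ.erase (0 : ZMod q), ∑ v,
        b (u⁻¹ * (v - k * s)) * b (u⁻¹ * (v - k' * s)) ≤ if k = k' then q ^ 2 * B ^ 2 else 0 := by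
    intro k hk k' hk'
    have e1 : ∀ u ∈ Finset.univ.erase (0 : ZMod q), ∑ v,
        b (u⁻¹ * (v - k * s)) * b (u⁻¹ * (v - k' * s)) =
        ∑ w, b w * b (w + u⁻¹ * ((k - k') * s)) := by
      intro u hu
      have hu0 := Finset.ne_of_mem_erase hu
      refine (Equiv.sum_comp ((Equiv.mulLeft₀ u hu0).trans (Equiv.addRight ((k : ZMod q) * s)))
        (fun v => b (u⁻¹ * (v - k * s)) * b (u⁻¹ * (v - k' * s)))).symm.trans ?_
      refine Finset.sum_congr rfl fun w _ => ?_
      change b (u⁻¹ * ((u * w + k * s) - k * s)) * b (u⁻¹ * ((u * w + k * s) - k' * s)) = _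
      congr 2
      · field_simp; ring
      · field_simp; ring
    rw [Finset.sum_congr rfl e1]
    by_cases h : k = k'
    · subst h
      simp only [if_true, sub_self, zero_mul, mul_zero, add_zero]
      calc _ ≤ ∑ u ∈ Finset.univ.erase (0 : ZMod q), ∑ w : ZMod q, B ^ 2 := by
            refine Finset.sum_le_sum fun u _ => Finset.sum_le_sum fun w _ => ?_
            rw [← sq]; exact hB w
        _ ≤ ∑ u : ZMod q, ∑ w : ZMod q, B ^ 2 :=
            Finset.sum_le_sum_of_subset_of_nonneg (Finset.erase_subset _ _)
              fun _ _ _ => Finset.sum_nonneg fun _ _ => sq_nonneg _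
        _ = _ := by simp [ZMod.card]; ring
    · simp only [h, if_false]
      have hc : ((k : ZMod q) - k') * s ≠ 0 := by
        refine mul_ne_zero (fun h0 => h ?_) hs
        have := sub_eq_zero.mp h0
        exact cast_injOn q (by simp at hk ⊢; omega) (by simp at hk' ⊢; omega) this
      set c := ((k : ZMod q) - k') * s
      rw [Finset.sum_comm]
      have e2 : ∀ w, ∑ u ∈ Finset.univ.erase (0 : ZMod q), b w * b (w + u⁻¹ * c) = - b w ^ 2 := by
        intro w
        rw [← Finset.mul_sum]
        have e3 := Finset.sum_erase_add (s := Finset.univ) (fun u : ZMod q => b (w + u⁻¹ * c))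
          (Finset.mem_univ 0)
        have e4 : ∑ u : ZMod q, b (w + u⁻¹ * c) = 0 := by
          rw [← hb0]
          exact Equiv.sum_comp (((Equiv.inv (ZMod q)).trans (Equiv.mulRight₀ c hc)).trans
            (Equiv.addLeft w)) b
        simp only [inv_zero, zero_mul, add_zero] at e3
        have : ∑ u ∈ Finset.univ.erase (0 : ZMod q), b (w + u⁻¹ * c) = - b w := by linarith
        rw [this]; ring
      rw [Finset.sum_congr rfl fun w _ => e2 w]
      exact Finset.sum_nonpos fun w _ => by have := sq_nonneg (b w); linarith
  calc _ = ∑ k ∈ Finset.range K, ∑ k' ∈ Finset.range K,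
      ∑ u ∈ Finset.univ.erase (0 : ZMod q), ∑ v,
        b (u⁻¹ * (v - k * s)) * b (u⁻¹ * (v - k' * s)) := by
        simp_rw [sq, Finset.sum_mul_sum]
        rw [Finset.sum_congr rfl fun u _ => Finset.sum_comm]
        rw [Finset.sum_comm]
        refine Finset.sum_congr rfl fun k _ => ?_
        rw [Finset.sum_congr rfl fun u _ => Finset.sum_comm]
        rw [Finset.sum_comm]
    _ ≤ ∑ k ∈ Finset.range K, ∑ k' ∈ Finset.range K, (if k = k' then q ^ 2 * B ^ 2 else 0) :=
        Finset.sum_le_sum fun k hk => Finset.sum_le_sum fun k' hk' => hpair k hk k' hk'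
    _ = _ := by
        rw [Finset.sum_congr rfl (g := fun _ => (q:ℝ) ^ 2 * B ^ 2)]
        · simp
        · intro k hk
          rw [Finset.sum_ite_eq, if_pos hk]

theorem typeII (q : ℕ) [hq : Fact q.Prime] (f α β : ZMod q → ℝ) (A B τ : ℝ) (K : ℕ) (hK0 : 0 < K)
    (hK : K ≤ q) (s : ZMod q) (hs : s ≠ 0) (fs : ∑ v, f v = 0) (hf : ∀ v, |f v| ≤ 1)
    (hα0 : ∀ v, 0 ≤ α v) (hα : ∀ v, α v ≤ A) (hα00 : α 0 = 0)
    (hβ0 : ∀ v, 0 ≤ β v) (hβ : ∀ v, β v ≤ B)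
    (hsh : ∀ k < K, ∑ v, |f (v + k * s) - f v| ≤ τ * q) :
    |∑ u, ∑ w, α u * β w * f (u * w)| ≤ A * B * q ^ 2 * (τ + 1 / Real.sqrt K) := by
  have hqR : (0:ℝ) < q := by exact_mod_cast hq.out.pos
  have hKR : (0:ℝ) < K := by exact_mod_cast hK0
  have hA : 0 ≤ A := (hα0 0).trans (hα 0)
  have hB : 0 ≤ B := (hβ0 0).trans (hβ 0)
  set m := (∑ v, β v) / q with hm
  have hm0 : 0 ≤ m := div_nonneg (Finset.sum_nonneg fun v _ => hβ0 v) hqR.le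
  have hmB : m ≤ B := by
    rw [hm, div_le_iff₀ hqR]
    calc ∑ v, β v ≤ ∑ v : ZMod q, B := Finset.sum_le_sum fun v _ => hβ v
      _ = B * q := by simp [ZMod.card]; ring
  set b : ZMod q → ℝ := fun v => β v - m with hbdef
  have hb : ∀ v, |b v| ≤ B := fun v => by
    rw [abs_le]; constructor <;> simp only [hbdef] <;> linarith [hβ0 v, hβ v]
  have hb0 : ∑ v, b v = 0 := by
    simp only [hbdef, Finset.sum_sub_distrib]
    simp [ZMod.card, hm]; field_simp; simp
  set G : ZMod q → ZMod q → ℝ := fun u v => ∑ k ∈ Finset.range K, b (u⁻¹ * (v - k * s)) with hG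
  have hR : ∀ u ∈ Finset.univ.erase (0 : ZMod q),
      K * |∑ w, β w * f (u * w)| ≤ K * (B * (τ * q)) + ∑ v, |G u v| := by
    intro u hu
    have hu0 := Finset.ne_of_mem_erase hu
    have e1 : ∀ k ∈ Finset.range K, ∑ w, β w * f (u * w + k * s) =
        ∑ v, f v * b (u⁻¹ * (v - k * s)) := by
      intro k _
      have : ∑ v, f v * b (u⁻¹ * (v - k * s)) = ∑ v, f v * β (u⁻¹ * (v - k * s)) := by
        simp only [hbdef, mul_sub, Finset.sum_sub_distrib, ← Finset.sum_mul, fs]; simp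
      rw [this]
      refine Eq.trans ?_ (Equiv.sum_comp ((Equiv.mulLeft₀ u hu0).trans
        (Equiv.addRight ((k : ZMod q) * s))) (fun v => f v * β (u⁻¹ * (v - k * s))))
      refine Finset.sum_congr rfl fun w _ => ?_
      change _ = f (u * w + k * s) * β (u⁻¹ * (u * w + k * s - k * s))
      rw [add_sub_cancel_right, inv_mul_cancel_left₀ hu0, mul_comm]
    have e2 : (K:ℝ) * ∑ w, β w * f (u * w) =
        ∑ k ∈ Finset.range K, ∑ w, β w * (f (u * w) - f (u * w + k * s)) + ∑ v, f v * G u v := by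
      have : ∑ v, f v * G u v = ∑ k ∈ Finset.range K, ∑ w, β w * f (u * w + k * s) := by
        rw [Finset.sum_congr rfl e1, Finset.sum_comm]
        simp only [hG, Finset.mul_sum]
      rw [this, ← Finset.sum_add_distrib]
      simp only [← Finset.sum_add_distrib, mul_sub, sub_add_cancel]
      simp
    have e3 : |∑ k ∈ Finset.range K, ∑ w, β w * (f (u * w) - f (u * w + k * s))| ≤
        K * (B * (τ * q)) := by
      calc _ ≤ ∑ k ∈ Finset.range K, |∑ w, β w * (f (u * w) - f (u * w + k * s))| :=
            Finset.abs_sum_le_sum_abs _ _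
        _ ≤ ∑ k ∈ Finset.range K, B * (τ * q) := by
            refine Finset.sum_le_sum fun k hk => ?_
            calc _ ≤ ∑ w, |β w * (f (u * w) - f (u * w + k * s))| :=
                  Finset.abs_sum_le_sum_abs _ _
              _ ≤ ∑ w, B * |f (u * w + k * s) - f (u * w)| := by
                  refine Finset.sum_le_sum fun w _ => ?_
                  rw [abs_mul, abs_of_nonneg (hβ0 w), abs_sub_comm]
                  gcongr; exact hβ w
              _ = B * ∑ v, |f (v + k * s) - f v| := by
                  rw [← Finset.mul_sum, sum_mul_unit q (fun v => |f (v + k * s) - f v|) u hu0]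
              _ ≤ _ := mul_le_mul_of_nonneg_left (hsh k (Finset.mem_range.mp hk)) hB
        _ = _ := by simp
    have e4 : |∑ v, f v * G u v| ≤ ∑ v, |G u v| := by
      refine (Finset.abs_sum_le_sum_abs _ _).trans (Finset.sum_le_sum fun v _ => ?_)
      rw [abs_mul]
      have := abs_nonneg (G u v)
      nlinarith [hf v]
    have e5 : K * |∑ w, β w * f (u * w)| = |(K:ℝ) * ∑ w, β w * f (u * w)| := by
      rw [abs_mul, abs_of_pos hKR]
    rw [e5, e2]
    exact (abs_add_le _ _).trans (add_le_add e3 e4)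
  -- variance
  have hvar := tII_var q b B K hK s hs hb hb0
  have hcs : ∑ u ∈ Finset.univ.erase (0 : ZMod q), ∑ v, |G u v| ≤ q ^ 2 * B * Real.sqrt K := by
    have h1 : (∑ x ∈ Finset.univ.erase (0 : ZMod q) ×ˢ (Finset.univ : Finset (ZMod q)),
        |G x.1 x.2|) ^ 2 ≤ (q ^ 2 * B * Real.sqrt K) ^ 2 := by
      calc _ ≤ ((Finset.univ.erase (0 : ZMod q) ×ˢ (Finset.univ : Finset (ZMod q))).card : ℝ) *
            ∑ x ∈ Finset.univ.erase (0 : ZMod q) ×ˢ (Finset.univ : Finset (ZMod q)),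
              |G x.1 x.2| ^ 2 := sq_sum_le_card_mul_sum_sq
        _ ≤ (q ^ 2 : ℝ) * (K * (q ^ 2 * B ^ 2)) := by
            gcongr
            · rw [Finset.card_product, Finset.card_univ, ZMod.card, sq]
              push_cast
              gcongr
              refine (Finset.card_le_card (Finset.erase_subset _ _)).trans ?_
              rw [Finset.card_univ, ZMod.card]
            · rw [Finset.sum_product]
              simp only [sq_abs]
              exact hvar
        _ = _ := by rw [mul_pow, mul_pow, Real.sq_sqrt hKR.le]; ring
    rw [Finset.sum_product] at h1
    exact le_of_sq_le_sq h1 (by positivity)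
  have hsum := Finset.sum_le_sum hR
  rw [← Finset.mul_sum, Finset.sum_add_distrib, Finset.sum_const, nsmul_eq_mul] at hsum
  have hcard : ((Finset.univ.erase (0 : ZMod q)).card : ℝ) ≤ q := by
    have := Finset.card_le_card (Finset.erase_subset (0 : ZMod q) Finset.univ)
    rw [Finset.card_univ, ZMod.card] at this
    exact_mod_cast this
  have hτ : 0 ≤ τ * q := le_trans (Finset.sum_nonneg fun _ _ => abs_nonneg _) (hsh 0 hK0)
  have h6 : ∑ u ∈ Finset.univ.erase (0 : ZMod q), |∑ w, β w * f (u * w)| ≤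
      q ^ 2 * B * (τ + 1 / Real.sqrt K) := by
    have h7 : K * ∑ u ∈ Finset.univ.erase (0 : ZMod q), |∑ w, β w * f (u * w)| ≤
      K * (q ^ 2 * B * (τ + 1 / Real.sqrt K)) := by
      have h8 : ((Finset.univ.erase (0 : ZMod q)).card : ℝ) * (K * (B * (τ * q))) ≤
          q * (K * (B * (τ * q))) := by gcongr
      have h9 : K * (q ^ 2 * B * (τ + 1 / Real.sqrt K)) =
          q * (K * (B * (τ * q))) + q ^ 2 * B * (K / Real.sqrt K) := by ring
      rw [h9, Real.div_sqrt]
      linarith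
    exact le_of_mul_le_mul_left h7 hKR
  calc |∑ u, ∑ w, α u * β w * f (u * w)|
      = |∑ u ∈ Finset.univ.erase (0 : ZMod q), α u * ∑ w, β w * f (u * w)| := by
        congr 1
        rw [← Finset.sum_erase_add (s := Finset.univ) _ (Finset.mem_univ (0 : ZMod q))]
        simp only [hα00, zero_mul, Finset.sum_const_zero, add_zero, Finset.mul_sum, mul_assoc]
    _ ≤ ∑ u ∈ Finset.univ.erase (0 : ZMod q), A * |∑ w, β w * f (u * w)| := by
        refine (Finset.abs_sum_le_sum_abs _ _).trans (Finset.sum_le_sum fun u _ => ?_)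
        rw [abs_mul, abs_of_nonneg (hα0 u)]
        gcongr; exact hα u
    _ ≤ A * (q ^ 2 * B * (τ + 1 / Real.sqrt K)) := by
        rw [← Finset.mul_sum]; gcongr
    _ = _ := by ring


open ArithmeticFunction in
theorem bil_regroup (q : ℕ) [hq : Fact q.Prime] (f : ZMod q → ℝ) (f0 : f 0 = 0)
    (S T : Finset ℕ) :
    ∑ n ∈ S, ∑ m ∈ T, vonMangoldt n * vonMangoldt m * f ((n * m : ℕ) : ZMod q) =
    ∑ u, ∑ w, (if u = 0 then 0 else
        ∑ n ∈ S, if (n : ZMod q) = u then vonMangoldt n else 0) *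
      (if w = 0 then 0 else ∑ m ∈ T, if (m : ZMod q) = w then vonMangoldt m else 0) *
        f (u * w) := by
  have h1 : ∀ u w : ZMod q, (if u = 0 then 0 else
        ∑ n ∈ S, if (n : ZMod q) = u then vonMangoldt n else 0) *
      (if w = 0 then 0 else ∑ m ∈ T, if (m : ZMod q) = w then vonMangoldt m else 0) *
        f (u * w) = ∑ n ∈ S, ∑ m ∈ T, (if (n : ZMod q) = u then
          (if (m : ZMod q) = w then vonMangoldt n * vonMangoldt m * f (n * m) else 0) else 0) := by
    intro u w
    have e : ∑ n ∈ S, ∑ m ∈ T, (if (n : ZMod q) = u then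
          (if (m : ZMod q) = w then vonMangoldt n * vonMangoldt m * f (n * m) else 0) else 0)
        = (∑ n ∈ S, if (n : ZMod q) = u then vonMangoldt n else 0) *
      (∑ m ∈ T, if (m : ZMod q) = w then vonMangoldt m else 0) *
        f (u * w) := by
      rw [Finset.sum_mul_sum, Finset.sum_mul]
      refine Finset.sum_congr rfl fun n _ => ?_
      rw [Finset.sum_mul]
      refine Finset.sum_congr rfl fun m _ => ?_
      split_ifs with h1 h2
      · rw [h1, h2]
      · simp
      · simp
      · simp
    rw [e]
    split_ifs with h1 h2 h2
    · simp [h1, f0]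
    · simp [h1, f0]
    · simp [h2, f0]
    · rfl
  simp_rw [h1]
  symm
  calc _ = ∑ u, ∑ n ∈ S, ∑ m ∈ T, ∑ w, (if (n : ZMod q) = u then
          (if (m : ZMod q) = w then vonMangoldt n * vonMangoldt m * f (n * m) else 0) else 0) := by
        refine Finset.sum_congr rfl fun u _ => ?_
        rw [Finset.sum_comm]
        refine Finset.sum_congr rfl fun n _ => ?_
        rw [Finset.sum_comm]
    _ = ∑ n ∈ S, ∑ m ∈ T, ∑ u, ∑ w, (if (n : ZMod q) = u then
          (if (m : ZMod q) = w then vonMangoldt n * vonMangoldt m * f (n * m) else 0) else 0) := by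
        rw [Finset.sum_comm]
        refine Finset.sum_congr rfl fun n _ => ?_
        rw [Finset.sum_comm]
    _ = _ := by
        refine Finset.sum_congr rfl fun n _ => Finset.sum_congr rfl fun m _ => ?_
        have : ∀ u : ZMod q, ∑ w, (if (n : ZMod q) = u then
          (if (m : ZMod q) = w then vonMangoldt n * vonMangoldt m * f (n * m) else 0) else 0) =
          if (n : ZMod q) = u then vonMangoldt n * vonMangoldt m * f (n * m) else 0 := by
          intro u
          split_ifs
          · rw [Finset.sum_ite_eq]; simp
          · simp
        simp_rw [this]
        rw [Finset.sum_ite_eq]; simp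

open ArithmeticFunction in
theorem bil_small (X Y : ℕ) (hY : 0 < Y) :
    ∑ n ∈ Finset.Ioc 0 Y, ∑ m ∈ Finset.Ioc 0 (X / n), vonMangoldt n * vonMangoldt m ≤
      6 * X * (Real.log Y + 6) := by
  calc _ ≤ ∑ n ∈ Finset.Ioc 0 Y, 6 * X * (vonMangoldt n / n) := by
        refine Finset.sum_le_sum fun n hn => ?_
        rw [← Finset.mul_sum]
        have h1 := psi_nat_le (X / n)
        have h2 : ((X / n : ℕ) : ℝ) ≤ X / n := Nat.cast_div_le
        have h3 : (0:ℝ) ≤ vonMangoldt n := vonMangoldt_nonneg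
        calc _ ≤ vonMangoldt n * (6 * (X / n : ℝ)) := by gcongr; linarith
          _ = _ := by ring
    _ ≤ _ := by
        rw [← Finset.mul_sum]
        have := mertens_le Y hY
        gcongr

open ArithmeticFunction in
theorem bil_large (X Y : ℕ) (hY : 0 < Y) :
    ∑ n ∈ Finset.Ioc (X / Y) X, ∑ m ∈ Finset.Ioc 0 (X / n), vonMangoldt n * vonMangoldt m ≤
      6 * X * (Real.log Y + 6) := by
  rw [Finset.sum_comm' (t' := Finset.Ioc 0 Y) (s' := fun m => Finset.Ioc (X / Y) (X / m))]
  · refine le_trans (Finset.sum_le_sum fun m _ => ?_) (bil_small X Y hY)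
    calc _ ≤ ∑ n ∈ Finset.Ioc 0 (X / m), vonMangoldt n * vonMangoldt m :=
          Finset.sum_le_sum_of_subset_of_nonneg
            (Finset.Ioc_subset_Ioc_left (Nat.zero_le _))
            fun _ _ _ => mul_nonneg vonMangoldt_nonneg vonMangoldt_nonneg
      _ = _ := Finset.sum_congr rfl fun _ _ => mul_comm _ _
  · intro n m
    simp only [Finset.mem_Ioc]
    constructor
    · rintro ⟨⟨h1, h2⟩, h3, h4⟩
      have hn : 0 < n := lt_of_le_of_lt (Nat.zero_le _) h1
      have h5 : m * n ≤ X := (Nat.le_div_iff_mul_le hn).mp h4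
      refine ⟨⟨h1, (Nat.le_div_iff_mul_le h3).mpr (by rw [mul_comm]; exact h5)⟩, h3, ?_⟩
      by_contra hc
      have h6 := (Nat.div_lt_iff_lt_mul hY).mp h1
      have : n * Y ≤ n * m := Nat.mul_le_mul_left _ (by omega)
      rw [mul_comm n m] at this
      omega
    · rintro ⟨⟨h1, h2⟩, h3, h4⟩
      have hn : 0 < n := lt_of_le_of_lt (Nat.zero_le _) h1
      have h5 : n * m ≤ X := (Nat.le_div_iff_mul_le h3).mp h2
      refine ⟨⟨h1, h2.trans (Nat.div_le_self _ _)⟩, h3,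
        (Nat.le_div_iff_mul_le hn).mpr (by rw [mul_comm]; exact h5)⟩

open ArithmeticFunction in
/-- the contribution of one multiplicative window -/
theorem bil_window (q : ℕ) [hq : Fact q.Prime] (f : ZMod q → ℝ) (f0 : f 0 = 0)
    (fs : ∑ v, f v = 0) (hf : ∀ v, |f v| ≤ 1) (K : ℕ) (hK0 : 0 < K)
    (hK : K ≤ q) (s : ZMod q) (hs : s ≠ 0) (τ : ℝ) (hτ0 : 0 ≤ τ)
    (hsh : ∀ k < K, ∑ v, |f (v + k * s) - f v| ≤ τ * q) (S : Finset ℕ) (e M : ℝ) (he : 0 ≤ e)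
    (hM0 : 0 ≤ M)
    (Y : ℕ) (hqY : q ^ 2 ≤ Y) (hlY : Real.sqrt q ≤ Real.log Y)
    (hS : ∀ n ∈ S, Y < n ∧ (n : ℝ) ≤ e ∧ (Y : ℝ) ≤ M) :
    |∑ n ∈ S, ∑ m ∈ Finset.Ioc 0 ⌊M⌋₊,
      vonMangoldt n * vonMangoldt m * f ((n * m : ℕ) : ZMod q)| ≤
      2340 ^ 2 * (e * M) * (τ + 1 / Real.sqrt K) := by
  have hqR : (0:ℝ) < q := by exact_mod_cast hq.out.pos
  rcases S.eq_empty_or_nonempty with rfl | ⟨n0, hn0⟩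
  · simp; positivity
  have hY0 : 0 < Y := lt_of_lt_of_le (pow_pos hq.out.pos 2) hqY
  obtain ⟨h1, h2, h3⟩ := hS n0 hn0
  have hE : Y ≤ ⌊e⌋₊ := Nat.le_floor (le_trans (by exact_mod_cast h1.le) h2)
  have hM : Y ≤ ⌊M⌋₊ := Nat.le_floor h3
  have hlog : ∀ Z : ℕ, Y ≤ Z → Real.sqrt q ≤ Real.log Z := fun Z hZ =>
    hlY.trans (Real.log_le_log (by exact_mod_cast hY0) (by exact_mod_cast hZ))
  have hSs : S ⊆ Finset.Ioc 0 ⌊e⌋₊ := fun n hn => by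
    obtain ⟨a, b, c⟩ := hS n hn
    exact Finset.mem_Ioc.mpr ⟨by omega, Nat.le_floor b⟩
  have nn : ∀ (T : Finset ℕ) (u : ZMod q),
      0 ≤ ∑ n ∈ T, if (n : ZMod q) = u then (vonMangoldt n : ℝ) else 0 := fun T u =>
    Finset.sum_nonneg fun n _ => by split_ifs; exacts [vonMangoldt_nonneg, le_rfl]
  rw [bil_regroup q f f0]
  have := typeII q f (fun u => if u = 0 then 0 else
        ∑ n ∈ S, if (n : ZMod q) = u then vonMangoldt n else 0)
      (fun w => if w = 0 then 0 else ∑ m ∈ Finset.Ioc 0 ⌊M⌋₊,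
        if (m : ZMod q) = w then vonMangoldt m else 0)
      (2340 * (e / q)) (2340 * (M / q)) τ K hK0 hK s hs fs hf ?_ ?_ ?_ ?_ ?_ hsh
  · refine this.trans (le_of_eq ?_)
    field_simp
  · intro v; split_ifs; exacts [le_rfl, nn _ _]
  · intro v; split_ifs with hv
    · positivity
    · calc _ ≤ ∑ n ∈ Finset.Ioc 0 ⌊e⌋₊, (if (n : ZMod q) = v then vonMangoldt n else 0) :=
            Finset.sum_le_sum_of_subset_of_nonneg hSs
              fun _ _ _ => by split_ifs; exacts [vonMangoldt_nonneg, le_rfl]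
        _ ≤ 2340 * ((⌊e⌋₊ : ℝ) / q) := bt q ⌊e⌋₊ (hqY.trans hE) (hlog _ hE) v hv
        _ ≤ _ := by gcongr; exact Nat.floor_le he
  · simp
  · intro v; split_ifs; exacts [le_rfl, nn _ _]
  · intro v; split_ifs with hv
    · positivity
    · calc _ ≤ 2340 * ((⌊M⌋₊ : ℝ) / q) := bt q ⌊M⌋₊ (hqY.trans hM) (hlog _ hM) v hv
        _ ≤ _ := by gcongr; exact Nat.floor_le hM0

open ArithmeticFunction in
theorem bil_mid (q : ℕ) [hq : Fact q.Prime] (f : ZMod q → ℝ) (f0 : f 0 = 0)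
    (fs : ∑ v, f v = 0) (hf : ∀ v, |f v| ≤ 1) (K : ℕ) (hK0 : 0 < K)
    (hK : K ≤ q) (s : ZMod q) (hs : s ≠ 0) (τ : ℝ) (hτ0 : 0 ≤ τ)
    (hsh : ∀ k < K, ∑ v, |f (v + k * s) - f v| ≤ τ * q)
    (X Y : ℕ) (hX : 0 < X) (hqY : q ^ 2 ≤ Y) (hlY : Real.sqrt q ≤ Real.log Y)
    (κ η y0 : ℝ) (hκ : 0 < κ) (hη : 0 < η)
    (hw : ∀ y : ℝ, y0 ≤ y → ∀ x : ℝ, y ≤ x → x ≤ Real.exp η * y →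
      ∑ n ∈ Finset.Ioc ⌊y⌋₊ ⌊x⌋₊, vonMangoldt n ≤ κ * y) (hy0 : y0 ≤ Y) :
    |∑ n ∈ Finset.Ioc Y (X / Y), ∑ m ∈ Finset.Ioc 0 (X / n),
      vonMangoldt n * vonMangoldt m * f ((n * m : ℕ) : ZMod q)| ≤
      κ * X * (Real.log X + 6) +
      (Real.log X / η + 1) * (2340 ^ 2 * (Real.exp η * X) * (τ + 1 / Real.sqrt K)) := by
  have hY0 : 0 < Y := lt_of_lt_of_le (pow_pos hq.out.pos 2) hqY
  set S := Finset.Ioc Y (X / Y) with hS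
  set jn : ℕ → ℕ := fun n => ⌊Real.log n / η⌋₊ with hjn
  set M : ℕ → ℝ := fun j => X * Real.exp (-(η * j)) with hM
  have hXR : (0:ℝ) < X := by exact_mod_cast hX
  have hSn : ∀ n ∈ S, Y < n ∧ n * Y ≤ X ∧ 0 < n ∧ n ≤ X := fun n hn => by
    have := Finset.mem_Ioc.mp hn
    refine ⟨this.1, (Nat.le_div_iff_mul_le hY0).mp this.2, by omega, this.2.trans (Nat.div_le_self _ _)⟩
  have hj1 : ∀ n ∈ S, Real.exp (η * jn n) ≤ n := fun n hn => by
    obtain ⟨-, -, hn0, -⟩ := hSn n hn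
    have hnR : (0:ℝ) < n := by exact_mod_cast hn0
    rw [← Real.le_log_iff_exp_le hnR]
    have := Nat.floor_le (a := Real.log n / η) (div_nonneg (Real.log_natCast_nonneg n) hη.le)
    rw [le_div_iff₀ hη] at this
    rw [mul_comm]; exact this
  have hj2 : ∀ n ∈ S, (n:ℝ) ≤ Real.exp (η * (jn n + 1)) := fun n hn => by
    obtain ⟨-, -, hn0, -⟩ := hSn n hn
    have hnR : (0:ℝ) < n := by exact_mod_cast hn0
    rw [← Real.log_le_iff_le_exp hnR]
    have := (Nat.lt_floor_add_one (Real.log n / η)).le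
    rw [div_le_iff₀ hη] at this
    rw [mul_comm]; exact this
  have hM1 : ∀ n ∈ S, (X / n : ℝ) ≤ M (jn n) := fun n hn => by
    obtain ⟨-, -, hn0, -⟩ := hSn n hn
    have hnR : (0:ℝ) < n := by exact_mod_cast hn0
    simp only [hM]
    rw [Real.exp_neg, ← div_eq_mul_inv]
    gcongr; exact hj1 n hn
  have hM2 : ∀ n ∈ S, M (jn n) ≤ Real.exp η * (X / n : ℝ) := fun n hn => by
    obtain ⟨-, -, hn0, -⟩ := hSn n hn
    have hnR : (0:ℝ) < n := by exact_mod_cast hn0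
    have := hj2 n hn
    have e : Real.exp η * (X / n : ℝ) = M (jn n) * (Real.exp (η * (jn n + 1)) / n) := by
      simp only [hM]
      have : Real.exp (η * (jn n + 1)) = Real.exp η * Real.exp (η * jn n) := by
        rw [← Real.exp_add]; ring_nf
      rw [this, Real.exp_neg]
      field_simp
    rw [e]
    have hMp : 0 ≤ M (jn n) := by simp only [hM]; positivity
    exact le_mul_of_one_le_right hMp ((one_le_div hnR).mpr this)
  have hXn : ∀ n ∈ S, (Y : ℝ) ≤ X / n := fun n hn => by
    obtain ⟨-, h, hn0, -⟩ := hSn n hn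
    have hnR : (0:ℝ) < n := by exact_mod_cast hn0
    rw [le_div_iff₀ hnR, mul_comm]; exact_mod_cast h
  have hsplit : ∀ n ∈ S, ∑ m ∈ Finset.Ioc 0 (X / n),
      vonMangoldt n * vonMangoldt m * f ((n * m : ℕ) : ZMod q) =
      ∑ m ∈ Finset.Ioc 0 ⌊M (jn n)⌋₊, vonMangoldt n * vonMangoldt m * f ((n * m : ℕ) : ZMod q) -
      ∑ m ∈ Finset.Ioc (X / n) ⌊M (jn n)⌋₊,
        vonMangoldt n * vonMangoldt m * f ((n * m : ℕ) : ZMod q) := fun n hn => by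
    have hle : X / n ≤ ⌊M (jn n)⌋₊ := Nat.le_floor (Nat.cast_div_le.trans (hM1 n hn))
    rw [eq_sub_iff_add_eq]
    exact Finset.sum_Ioc_consecutive _ (Nat.zero_le _) hle
  rw [Finset.sum_congr rfl hsplit, Finset.sum_sub_distrib]
  refine (abs_sub _ _).trans ?_
  rw [add_comm]
  refine add_le_add ?_ ?_
  · calc _ ≤ ∑ n ∈ S, κ * X * (vonMangoldt n / n) := by
          refine (Finset.abs_sum_le_sum_abs _ _).trans (Finset.sum_le_sum fun n hn => ?_)
          have h1 := hw (X / n) (hy0.trans (hXn n hn)) (M (jn n)) (hM1 n hn) (hM2 n hn)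
          rw [Nat.floor_div_eq_div] at h1
          have hΛ : (0:ℝ) ≤ vonMangoldt n := vonMangoldt_nonneg
          calc _ ≤ ∑ m ∈ Finset.Ioc (X / n) ⌊M (jn n)⌋₊, vonMangoldt n * vonMangoldt m := by
                refine (Finset.abs_sum_le_sum_abs _ _).trans (Finset.sum_le_sum fun m _ => ?_)
                have hΛ2 : (0:ℝ) ≤ vonMangoldt n * vonMangoldt m :=
                  mul_nonneg hΛ vonMangoldt_nonneg
                rw [abs_mul, abs_of_nonneg hΛ2]
                exact mul_le_of_le_one_right hΛ2 (hf _)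
            _ ≤ vonMangoldt n * (κ * (X / n)) := by
                rw [← Finset.mul_sum]; gcongr
            _ = _ := by ring
      _ ≤ κ * X * ∑ n ∈ Finset.Ioc 0 X, vonMangoldt n / n := by
          rw [← Finset.mul_sum]
          refine mul_le_mul_of_nonneg_left ?_ (by positivity)
          refine Finset.sum_le_sum_of_subset_of_nonneg ?_ fun n _ _ =>
            div_nonneg vonMangoldt_nonneg (Nat.cast_nonneg _)
          intro n hn
          obtain ⟨-, -, hn0, hnX⟩ := hSn n hn
          exact Finset.mem_Ioc.mpr ⟨hn0, hnX⟩
      _ ≤ _ := by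
          have := mertens_le X hX
          gcongr
  · have hlogX : 0 ≤ Real.log X := Real.log_natCast_nonneg X
    set J := ⌊Real.log X / η⌋₊ + 1 with hJ
    have hmap : ∀ n ∈ S, jn n ∈ Finset.range J := fun n hn => by
      obtain ⟨-, -, hn0, hnX⟩ := hSn n hn
      rw [Finset.mem_range, hJ, Nat.lt_succ_iff]
      apply Nat.floor_le_floor
      have hnR : (0:ℝ) < n := by exact_mod_cast hn0
      have : (n:ℝ) ≤ X := by exact_mod_cast hnX
      gcongr
    rw [← Finset.sum_fiberwise_of_maps_to hmap]
    calc _ ≤ ∑ j ∈ Finset.range J,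
          (2340 ^ 2 * (Real.exp η * X) * (τ + 1 / Real.sqrt K)) := by
          refine (Finset.abs_sum_le_sum_abs _ _).trans (Finset.sum_le_sum fun j _ => ?_)
          have e1 : ∑ n ∈ S with jn n = j, ∑ m ∈ Finset.Ioc 0 ⌊M (jn n)⌋₊,
              vonMangoldt n * vonMangoldt m * f ((n * m : ℕ) : ZMod q) =
              ∑ n ∈ S with jn n = j, ∑ m ∈ Finset.Ioc 0 ⌊M j⌋₊,
              vonMangoldt n * vonMangoldt m * f ((n * m : ℕ) : ZMod q) :=
            Finset.sum_congr rfl fun n hn => by rw [(Finset.mem_filter.mp hn).2]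
          rw [e1]
          have e2 : Real.exp η * X = Real.exp (η * (j + 1)) * M j := by
            simp only [hM]
            rw [mul_left_comm, ← Real.exp_add, mul_comm]; ring_nf
          rw [e2]
          refine bil_window q f f0 fs hf K hK0 hK s hs τ hτ0 hsh _ _ _ (Real.exp_nonneg _)
            (by simp only [hM]; positivity) Y hqY hlY ?_
          intro n hn
          obtain ⟨hn1, rfl⟩ := Finset.mem_filter.mp hn
          exact ⟨(hSn n hn1).1, hj2 n hn1, (hXn n hn1).trans (hM1 n hn1)⟩
      _ = J * (2340 ^ 2 * (Real.exp η * X) * (τ + 1 / Real.sqrt K)) := by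
          rw [Finset.sum_const, Finset.card_range, nsmul_eq_mul]
      _ ≤ _ := by
          gcongr
          rw [hJ]; push_cast
          gcongr
          exact Nat.floor_le (by positivity)

open ArithmeticFunction in
theorem Lam_log_bound (q : ℕ) [hq : Fact q.Prime] (f : ZMod q → ℝ) (f0 : f 0 = 0)
    (fs : ∑ v, f v = 0) (hf : ∀ v, |f v| ≤ 1) (K : ℕ) (hK0 : 0 < K)
    (hK : K ≤ q) (s : ZMod q) (hs : s ≠ 0) (τ : ℝ) (hτ0 : 0 ≤ τ)
    (hsh : ∀ k < K, ∑ v, |f (v + k * s) - f v| ≤ τ * q)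
    (X Y : ℕ) (hXY : Y ^ 2 ≤ X) (hqY : q ^ 2 ≤ Y) (hlY : Real.sqrt q ≤ Real.log Y)
    (κ η y0 : ℝ) (hκ : 0 < κ) (hη : 0 < η)
    (hw : ∀ y : ℝ, y0 ≤ y → ∀ x : ℝ, y ≤ x → x ≤ Real.exp η * y →
      ∑ n ∈ Finset.Ioc ⌊y⌋₊ ⌊x⌋₊, vonMangoldt n ≤ κ * y) (hy0 : y0 ≤ Y) :
    |∑ n ∈ Finset.Ioc 0 X, f n * (vonMangoldt n * Real.log n)| ≤
      420 * (Real.sqrt q * X) + 12 * X * (Real.log Y + 6) +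
      (κ * X * (Real.log X + 6) +
      (Real.log X / η + 1) * (2340 ^ 2 * (Real.exp η * X) * (τ + 1 / Real.sqrt K))) := by
  have hqR : (0:ℝ) < q := by exact_mod_cast hq.out.pos
  have hY0 : 0 < Y := lt_of_lt_of_le (pow_pos hq.out.pos 2) hqY
  have hYX : Y ≤ X := le_trans (Nat.le_self_pow (by norm_num) Y) hXY
  have hX : 0 < X := by omega
  have h1 : |∑ n ∈ Finset.Ioc 0 X, f n * Lam2 n| ≤ 420 * (Real.sqrt q * X) := by
    refine (typeI q f f0 fs X (hqY.trans hYX)).trans ?_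
    have : ∑ v, |f v| ≤ q := by
      refine (Finset.sum_le_sum fun v _ => hf v).trans ?_
      simp [ZMod.card]
    calc _ ≤ 420 * (q:ℝ) * (X / Real.sqrt q) := by gcongr
      _ = 420 * ((q / Real.sqrt q) * X) := by ring
      _ = _ := by rw [Real.div_sqrt]
  have h2 : ∑ n ∈ Finset.Ioc 0 X, f n * (vonMangoldt n * Real.log n) =
      ∑ n ∈ Finset.Ioc 0 X, f n * Lam2 n -
      ∑ n ∈ Finset.Ioc 0 X, ∑ m ∈ Finset.Ioc 0 (X / n),
      vonMangoldt n * vonMangoldt m * f ((n * m : ℕ) : ZMod q) := by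
    rw [← conv_sum (fun n => f (n : ZMod q)) (fun n => vonMangoldt n) (fun n => vonMangoldt n),
      ← Finset.sum_sub_distrib]
    refine Finset.sum_congr rfl fun n _ => ?_
    unfold Lam2; ring
  have h3 := bil_mid q f f0 fs hf K hK0 hK s hs τ hτ0 hsh X Y hX hqY hlY κ η y0 hκ hη hw hy0
  set F : ℕ → ℝ := fun n => ∑ m ∈ Finset.Ioc 0 (X / n),
      vonMangoldt n * vonMangoldt m * f ((n * m : ℕ) : ZMod q) with hF
  have hFabs : ∀ n, |F n| ≤ ∑ m ∈ Finset.Ioc 0 (X / n), vonMangoldt n * vonMangoldt m := by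
    intro n
    refine (Finset.abs_sum_le_sum_abs _ _).trans (Finset.sum_le_sum fun m _ => ?_)
    have hΛ2 : (0:ℝ) ≤ vonMangoldt n * vonMangoldt m :=
      mul_nonneg vonMangoldt_nonneg vonMangoldt_nonneg
    rw [abs_mul, abs_of_nonneg hΛ2]
    exact mul_le_of_le_one_right hΛ2 (hf _)
  have h4 : |∑ n ∈ Finset.Ioc 0 Y, F n| ≤ 6 * X * (Real.log Y + 6) :=
    ((Finset.abs_sum_le_sum_abs _ _).trans (Finset.sum_le_sum fun n _ => hFabs n)).trans
      (bil_small X Y hY0)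
  have h5 : |∑ n ∈ Finset.Ioc (X / Y) X, F n| ≤ 6 * X * (Real.log Y + 6) :=
    ((Finset.abs_sum_le_sum_abs _ _).trans (Finset.sum_le_sum fun n _ => hFabs n)).trans
      (bil_large X Y hY0)
  have hle : Y ≤ X / Y := (Nat.le_div_iff_mul_le hY0).mpr (by rw [← sq]; exact hXY)
  have h6 : ∑ n ∈ Finset.Ioc 0 X, F n = ∑ n ∈ Finset.Ioc 0 Y, F n +
      ∑ n ∈ Finset.Ioc Y (X / Y), F n + ∑ n ∈ Finset.Ioc (X / Y) X, F n := by
    rw [Finset.sum_Ioc_consecutive _ (Nat.zero_le _) hle,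
      Finset.sum_Ioc_consecutive _ (Nat.zero_le _) (Nat.div_le_self _ _)]
  rw [h2, h6]
  rw [abs_le] at *
  constructor <;> linarith [h1.1, h1.2, h3.1, h3.2, h4.1, h4.2, h5.1, h5.2]


open ArithmeticFunction in
theorem prime_pass (ε : ℝ) (hε : 0 < ε) : ∃ X1 : ℝ, ∀ X : ℕ, X1 ≤ X → ∀ F : ℕ → ℝ, (∀ n, |F n| ≤ 1) →
    |∑ n ∈ Finset.Ioc 0 X, F n * (vonMangoldt n * Real.log n)| ≤ ε * (X * Real.log X) →
    |∑ p ∈ (Finset.range (X + 1)).filter Nat.Prime, F p| ≤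
      12 * ε * ((Finset.range (X + 1)).filter Nat.Prime).card := by
  obtain ⟨C, hC⟩ := Chebyshev.primeCounting_sub_theta_div_log_isBigO.bound
  have e1 : ∀ᶠ x : ℝ in Filter.atTop, 2 * Real.log x ≤ ε * Real.sqrt x := by
    have := (isLittleO_log_rpow_atTop (r := 1 / 2) (by norm_num)).bound (c := ε / 2) (by positivity)
    filter_upwards [this, Filter.eventually_ge_atTop 1] with x hx hx1
    rw [← Real.sqrt_eq_rpow, Real.norm_of_nonneg (Real.log_nonneg hx1),
      Real.norm_of_nonneg (Real.sqrt_nonneg _)] at hx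
    linarith
  have e2 : ∀ᶠ x : ℝ in Filter.atTop, 2 * |C| / ε ≤ Real.log x :=
    Real.tendsto_log_atTop.eventually_ge_atTop _
  have e3 : ∀ᶠ x : ℝ in Filter.atTop, Real.log x ≤ (1 / 8) * x := by
    have := Real.isLittleO_log_id_atTop.bound (c := 1 / 8) (by positivity)
    filter_upwards [this, Filter.eventually_ge_atTop 1] with x hx hx1
    rw [id, Real.norm_of_nonneg (Real.log_nonneg hx1),
      Real.norm_of_nonneg (by linarith)] at hx
    exact hx
  obtain ⟨X1, hX1⟩ := Filter.eventually_atTop.mp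
    ((hC.and (e1.and (e2.and e3))).and (Filter.eventually_ge_atTop (8:ℝ)))
  refine ⟨X1, fun X hX F hF hsum => ?_⟩
  obtain ⟨⟨hC, h1, h2, h3⟩, h8⟩ := hX1 X hX
  have hX0 : 0 < X := by
    have : (0:ℝ) < X := by linarith
    exact_mod_cast this
  have hXR : (0:ℝ) < X := by exact_mod_cast hX0
  set L := Real.log X with hL
  have hL0 : 0 < L := Real.log_pos (by linarith)
  set P := (Finset.range (X + 1)).filter Nat.Prime with hP
  have hPI : P = (Finset.Ioc 0 X).filter Nat.Prime := by
    ext p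
    simp only [hP, Finset.mem_filter, Finset.mem_range, Finset.mem_Ioc]
    constructor
    · rintro ⟨a, b⟩; exact ⟨⟨b.pos, by omega⟩, b⟩
    · rintro ⟨⟨a, b⟩, c⟩; exact ⟨by omega, c⟩
  have hcard : (P.card : ℝ) = Nat.primeCounting X := by
    rw [Nat.primeCounting, Nat.primeCounting', Nat.count_eq_card_filter_range]
  have hlog : ∀ n ∈ Finset.Ioc 0 X, 0 ≤ Real.log n ∧ Real.log n ≤ L := fun n hn => by
    have := Finset.mem_Ioc.mp hn
    have h0 : (0:ℝ) < n := by exact_mod_cast this.1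
    exact ⟨Real.log_natCast_nonneg n, Real.log_le_log h0 (by exact_mod_cast this.2)⟩
  -- prime powers
  have hsplit : ∑ n ∈ Finset.Ioc 0 X, F n * (vonMangoldt n * Real.log n) =
      ∑ p ∈ P, F p * Real.log p ^ 2 +
      ∑ n ∈ Finset.Ioc 0 X with ¬ n.Prime, F n * (vonMangoldt n * Real.log n) := by
    rw [hPI, ← Finset.sum_filter_add_sum_filter_not (Finset.Ioc 0 X) Nat.Prime]
    congr 1
    refine Finset.sum_congr rfl fun p hp => ?_
    rw [vonMangoldt_apply_prime (Finset.mem_filter.mp hp).2]; ring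
  have hpp : |∑ n ∈ Finset.Ioc 0 X with ¬ n.Prime, F n * (vonMangoldt n * Real.log n)| ≤
      ε * (X * L) := by
    have hps := Chebyshev.psi_sub_theta_le (x := X) (by linarith)
    rw [Chebyshev.psi_sub_theta_eq_sum_not_prime, Nat.floor_natCast] at hps
    calc _ ≤ ∑ n ∈ Finset.Ioc 0 X with ¬ n.Prime, vonMangoldt n * L := by
          refine (Finset.abs_sum_le_sum_abs _ _).trans (Finset.sum_le_sum fun n hn => ?_)
          have hl := hlog n (Finset.mem_filter.mp hn).1
          have hΛ : (0:ℝ) ≤ vonMangoldt n := vonMangoldt_nonneg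
          rw [abs_mul, abs_of_nonneg (mul_nonneg hΛ hl.1)]
          calc _ ≤ 1 * (vonMangoldt n * Real.log n) := by
                have := mul_nonneg hΛ hl.1
                gcongr; exact hF n
            _ ≤ _ := by rw [one_mul]; gcongr; exact hl.2
      _ ≤ (2 * Real.sqrt X * L) * L := by rw [← Finset.sum_mul]; gcongr
      _ = (2 * L) * (Real.sqrt X * L) := by ring
      _ ≤ (ε * Real.sqrt X) * (Real.sqrt X * L) := by gcongr
      _ = ε * ((Real.sqrt X * Real.sqrt X) * L) := by ring
      _ = _ := by rw [Real.mul_self_sqrt hXR.le]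
  -- partial summation
  have hth : Chebyshev.theta X = ∑ p ∈ P, Real.log p := by
    rw [Chebyshev.theta, Nat.floor_natCast, hPI]
  have hps : |∑ p ∈ P, F p * (L ^ 2 - Real.log p ^ 2)| ≤ ε * (X * L) := by
    rw [Nat.floor_natCast, ← hcard, Real.norm_eq_abs, Real.norm_eq_abs,
      abs_of_nonneg (a := X / L ^ 2) (by positivity)] at hC
    have hC2 : P.card * L - Chebyshev.theta X ≤ |C| * (X / L) := by
      have h := (le_abs_self _).trans hC
      have h' : (P.card - Chebyshev.theta X / L) * L ≤ (|C| * (X / L ^ 2)) * L := by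
        gcongr
        refine h.trans ?_
        gcongr
        exact le_abs_self C
      have a1 : (P.card - Chebyshev.theta X / L) * L = P.card * L - Chebyshev.theta X := by
        field_simp
      have a2 : (|C| * (X / L ^ 2)) * L = |C| * (X / L) := by field_simp
      rw [a1, a2] at h'; exact h'
    calc _ ≤ ∑ p ∈ P, 2 * L * (L - Real.log p) := by
          refine (Finset.abs_sum_le_sum_abs _ _).trans (Finset.sum_le_sum fun p hp => ?_)
          rw [hPI] at hp
          obtain ⟨l0, l1⟩ := hlog p (Finset.mem_filter.mp hp).1
          have h0 : 0 ≤ L ^ 2 - Real.log p ^ 2 := by nlinarith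
          rw [abs_mul, abs_of_nonneg h0]
          calc _ ≤ 1 * (L ^ 2 - Real.log p ^ 2) := by gcongr; exact hF p
            _ ≤ _ := by nlinarith
      _ = 2 * L * (P.card * L - Chebyshev.theta X) := by
          rw [← Finset.mul_sum, Finset.sum_sub_distrib, hth, Finset.sum_const, nsmul_eq_mul]
      _ ≤ 2 * L * (|C| * (X / L)) := by gcongr
      _ = 2 * |C| * X := by field_simp
      _ ≤ (L * ε) * X := by
          rw [div_le_iff₀ hε] at h2
          exact mul_le_mul_of_nonneg_right h2 hXR.le
      _ = _ := by ring
  have hmain : L ^ 2 * |∑ p ∈ P, F p| ≤ 3 * ε * (X * L) := by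
    have e : L ^ 2 * ∑ p ∈ P, F p = ∑ p ∈ P, F p * Real.log p ^ 2 +
        ∑ p ∈ P, F p * (L ^ 2 - Real.log p ^ 2) := by
      rw [← Finset.sum_add_distrib, Finset.mul_sum]
      exact Finset.sum_congr rfl fun p _ => by ring
    have e' : L ^ 2 * |∑ p ∈ P, F p| = |L ^ 2 * ∑ p ∈ P, F p| := by
      rw [abs_mul, abs_of_nonneg (sq_nonneg L)]
    rw [e', e]
    rw [hsplit] at hsum
    rw [abs_le] at *
    constructor <;> linarith [hsum.1, hsum.2, hpp.1, hpp.2, hps.1, hps.2]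
  have hpi : X / (4 * L) ≤ P.card := by
    rw [hcard]
    refine le_trans ?_ (Chebyshev.pi_ge X)
    rw [div_le_div_iff₀ (by positivity) hL0]
    have a1 : Real.log (X + 1) ≤ L + Real.log 2 := by
      rw [hL, ← Real.log_mul (by positivity) (by positivity)]
      exact Real.log_le_log (by positivity) (by linarith)
    have a2 := Real.log_two_gt_d9
    have a3 := Real.log_two_lt_d9
    have a4 : X ≤ (X * Real.log 2 - Real.log (X + 1)) * 4 := by nlinarith
    calc X * L ≤ ((X * Real.log 2 - Real.log (X + 1)) * 4) * L := by gcongr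
      _ = _ := by ring
  have : |∑ p ∈ P, F p| ≤ 3 * ε * (X / L) := by
    have e : 3 * ε * (X * L) = L ^ 2 * (3 * ε * (X / L)) := by field_simp
    rw [e] at hmain
    exact le_of_mul_le_mul_left hmain (by positivity)
  calc _ ≤ 3 * ε * (X / L) := this
    _ = 12 * ε * (X / (4 * L)) := by field_simp; norm_num
    _ ≤ _ := by gcongr

set_option maxHeartbeats 1000000 in
theorem nt_main (ε d : ℝ) (hε : 0 < ε) (hd : 0 < d) : ∃ K : ℕ, 0 < K ∧ ∃ τ : ℝ, 0 < τ ∧ ∃ Q0 : ℝ,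
    ∀ (q : ℕ) [Fact q.Prime], Q0 ≤ q → ∀ (f : ZMod q → ℝ) (s : ZMod q) (X : ℕ), f 0 = 0 →
      ∑ v, f v = 0 → (∀ v, |f v| ≤ 1) → s ≠ 0 →
      (∀ k < K, ∑ v, |f (v + k * s) - f v| ≤ τ * q) → d * q ≤ Real.log X →
      |∑ p ∈ (Finset.range (X + 1)).filter Nat.Prime, f p| ≤
        ε * ((Finset.range (X + 1)).filter Nat.Prime).card := by
  obtain ⟨e, he0, he⟩ : ∃ e : ℝ, 0 < e ∧ 12 * e = ε := ⟨ε / 12, by positivity, by ring⟩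
  obtain ⟨X1, hX1⟩ := prime_pass e he0
  obtain ⟨η, hη0, hη1, y0, hy0, hw⟩ := window_bound (e / 8) (by positivity)
  set D : ℝ := 2 / η * (2340 ^ 2 * Real.exp η) with hD
  have hD0 : 0 < D := by positivity
  set τ : ℝ := e / (8 * D) with hτ
  have hτ0 : 0 < τ := by positivity
  obtain ⟨K, hK⟩ := exists_nat_gt ((1 / τ) ^ 2)
  have hKR : (0:ℝ) < K := lt_of_le_of_lt (sq_nonneg _) hK
  have hK0 : 0 < K := by exact_mod_cast hKR
  have hKτ : 1 / Real.sqrt K ≤ τ := by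
    rw [div_le_iff₀ (Real.sqrt_pos.mpr hKR), ← div_le_iff₀' hτ0]
    exact Real.le_sqrt_of_sq_le hK.le
  set R : ℝ := 3360 / (e * d) + 4 / d + 120 + y0 + K + |X1| / d with hR
  refine ⟨K, hK0, τ, hτ0, R ^ 2, fun q hq hRq f s X f0 fs hf hs hsh hX => ?_⟩
  set r : ℝ := Real.sqrt q with hr
  have t1 : 0 < 3360 / (e * d) := by positivity
  have t2 : 0 < 4 / d := by positivity
  have t3 : 0 ≤ |X1| / d := by positivity
  have hRr : R ≤ r := Real.le_sqrt_of_sq_le hRq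
  have hrr : r * r = q := Real.mul_self_sqrt (Nat.cast_nonneg q)
  have hr120 : 120 ≤ r := by linarith
  have hrd : 4 ≤ d * r := by
    have : 4 / d ≤ r := by linarith
    rwa [div_le_iff₀' hd] at this
  have hred : 3360 ≤ e * d * r := by
    have : 3360 / (e * d) ≤ r := by linarith
    rwa [div_le_iff₀' (by positivity)] at this
  have hX1r : |X1| ≤ d * r := by
    have : |X1| / d ≤ r := by linarith
    rwa [div_le_iff₀' hd] at this
  set L := Real.log X with hL
  have hdq : d * q = (d * r) * r := by rw [← hrr]; ring
  have hLr : (d * r) * r ≤ L := by rw [← hdq]; exact hX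
  have hL4 : 4 * r ≤ L := le_trans (by gcongr) hLr
  have hX0 : 0 < X := by
    rcases Nat.eq_zero_or_pos X with h | h
    · rw [hL, h] at hL4; simp at hL4; linarith
    · exact h
  have hXR : (0:ℝ) < X := by exact_mod_cast hX0
  have hLX : L ≤ X := (Real.log_le_sub_one_of_pos hXR).trans (by linarith)
  have hXX1 : X1 ≤ X := by
    have : |X1| * 1 ≤ (d * r) * r := by gcongr; linarith
    linarith [le_abs_self X1]
  rw [← he]
  refine hX1 X hXX1 (fun n => f n) (fun n => hf n) ?_
  set Y : ℕ := ⌈Real.exp r⌉₊ with hY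
  have hYge : Real.exp r ≤ Y := Nat.le_ceil _
  have hYlt : (Y:ℝ) < Real.exp r + 1 := Nat.ceil_lt_add_one (Real.exp_nonneg _)
  have hYpos : (0:ℝ) < Y := lt_of_lt_of_le (Real.exp_pos _) hYge
  have hlY1 : r ≤ Real.log Y := (Real.le_log_iff_exp_le hYpos).mpr hYge
  have hlY2 : Real.log Y ≤ r + 1 := by
    rw [Real.log_le_iff_le_exp hYpos, Real.exp_add]
    have := Real.add_one_le_exp (1:ℝ)
    have := Real.one_le_exp (x := r) (by linarith)
    nlinarith
  have hqY : q ^ 2 ≤ Y := by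
    have h5 := Real.pow_div_factorial_le_exp r (by linarith) 5
    have : (q:ℝ) ^ 2 ≤ Y := by
      refine le_trans ?_ hYge
      refine le_trans ?_ h5
      rw [← hrr, le_div_iff₀ (by positivity)]
      have : (Nat.factorial 5 : ℝ) = 120 := by norm_num [Nat.factorial]
      rw [this]
      calc (r * r) ^ 2 * 120 ≤ (r * r) ^ 2 * r := by gcongr
        _ = r ^ 5 := by ring
    exact_mod_cast this
  have hXY : Y ^ 2 ≤ X := by
    have : (Y:ℝ) ^ 2 ≤ X := by
      rw [← Real.log_le_log_iff (by positivity) hXR, Real.log_pow]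
      push_cast; linarith
    exact_mod_cast this
  have hyY : y0 ≤ Y := by
    have := Real.add_one_le_exp r
    have : (0:ℝ) ≤ K := hKR.le
    linarith
  have hKq : K ≤ q := by
    have h1 : (K:ℝ) ≤ r := by linarith
    have h2 : r * 1 ≤ r * r := by gcongr; linarith
    have : (K:ℝ) ≤ q := by linarith
    exact_mod_cast this
  refine (Lam_log_bound q f f0 fs hf K hK0 hKq s hs τ hτ0.le hsh X Y hXY hqY hlY1 (e / 8) η y0
    (by positivity) hη0 hw hyY).trans ?_
  have heL : 3360 * r ≤ e * L := by
    calc 3360 * r ≤ (e * d * r) * r := by gcongr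
      _ = e * ((d * r) * r) := by ring
      _ ≤ _ := by gcongr
  have b1 : 420 * (r * X) ≤ (e / 8) * (X * L) := by
    calc 420 * (r * X) = (3360 * r) * X / 8 := by ring
      _ ≤ (e * L) * X / 8 := by gcongr
      _ = _ := by ring
  have b2 : 12 * X * (Real.log Y + 6) ≤ (e / 8) * (X * L) := by
    have : 12 * (Real.log Y + 6) ≤ (e / 8) * L := by linarith
    calc _ = X * (12 * (Real.log Y + 6)) := by ring
      _ ≤ X * ((e / 8) * L) := by gcongr
      _ = _ := by ring
  have b3 : e / 8 * X * (L + 6) ≤ (e / 4) * (X * L) := by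
    have : L + 6 ≤ 2 * L := by linarith
    calc _ ≤ e / 8 * X * (2 * L) := by gcongr
      _ = _ := by ring
  have b4 : (L / η + 1) * (2340 ^ 2 * (Real.exp η * X) * (τ + 1 / Real.sqrt K)) ≤
      (e / 4) * (X * L) := by
    have h1 : L / η + 1 ≤ 2 / η * L := by
      have : 1 ≤ L / η := by rw [le_div_iff₀ hη0]; linarith
      have : 2 / η * L = L / η + L / η := by ring
      linarith
    calc _ ≤ (2 / η * L) * (2340 ^ 2 * (Real.exp η * X) * (τ + τ)) := by gcongr
      _ = 2 * (D * τ) * (X * L) := by rw [hD]; ring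
      _ = _ := by
        have : D * τ = e / 8 := by rw [hτ]; field_simp
        rw [this]; ring
  have : 0 ≤ e * (X * L) := by positivity
  linarith


/-- the normalised function on residues attached to a sequence -/
noncomputable def resFun (q : ℕ) (h : ℕ → ℝ) (m B : ℝ) (v : ZMod q) : ℝ :=
  if v = 0 then 0 else (h v.val - m) / (2 * B)

theorem resFun_abs (q : ℕ) (h : ℕ → ℝ) (m B : ℝ) (hB : 0 < B) (hh : ∀ a, |h a| ≤ B)
    (hm : |m| ≤ B) (v : ZMod q) : |resFun q h m B v| ≤ 1 := by
  unfold resFun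
  split_ifs
  · simp
  · rw [abs_div, abs_of_pos (by positivity : 0 < 2 * B), div_le_one (by positivity)]
    have := abs_sub (h v.val) m
    linarith [hh v.val]

theorem shift_bound (q q' k : ℕ) [hq : Fact q.Prime] (h : ℕ → ℝ) (m B e : ℝ) (hB : 0 < B)
    (hh : ∀ a, |h a| ≤ B) (hm : |m| ≤ B) (he : 0 ≤ e)
    (hc : ∀ a, |h (a + k * q') - h a| ≤ 2 * B * e) :
    ∑ v : ZMod q, |resFun q h m B (v + k * (q' : ZMod q)) - resFun q h m B v| ≤
      e * q + 2 + 2 * (k * q') := by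
  have hpt : ∀ v : ZMod q, |resFun q h m B (v + k * (q' : ZMod q)) - resFun q h m B v| ≤
      e + (if v = 0 then 2 else 0) + (if q ≤ v.val + k * q' then 2 else 0) := by
    intro v
    have h2 : |resFun q h m B (v + k * (q' : ZMod q)) - resFun q h m B v| ≤ 2 := by
      refine (abs_sub _ _).trans ?_
      linarith [resFun_abs q h m B hB hh hm (v + k * (q' : ZMod q)),
        resFun_abs q h m B hB hh hm v]
    by_cases h0 : v = 0
    · rw [if_pos h0]; split_ifs <;> linarith
    by_cases h1 : q ≤ v.val + k * q'
    · rw [if_pos h1]; split_ifs; linarith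
    rw [if_neg h0, if_neg h1]
    have hval : (v + k * (q' : ZMod q)).val = v.val + k * q' := by
      have : v + k * (q' : ZMod q) = ((v.val + k * q' : ℕ) : ZMod q) := by
        push_cast; rw [ZMod.natCast_zmod_val]
      rw [this, ZMod.val_cast_of_lt (by omega)]
    have hne : v + k * (q' : ZMod q) ≠ 0 := by
      intro h3
      rw [h3, ZMod.val_zero] at hval
      have : v.val ≠ 0 := fun h4 => h0 ((ZMod.val_eq_zero v).mp h4)
      omega
    simp only [resFun, if_neg h0, if_neg hne, hval]
    rw [← sub_div, sub_sub_sub_cancel_right, abs_div, abs_of_pos (by positivity : 0 < 2 * B),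
      div_le_iff₀ (by positivity)]
    linarith [hc v.val]
  refine (Finset.sum_le_sum fun v _ => hpt v).trans ?_
  rw [Finset.sum_add_distrib, Finset.sum_add_distrib]
  have c1 : ∑ v : ZMod q, e = e * q := by simp [ZMod.card]; ring
  have c2 : ∑ v : ZMod q, (if v = 0 then (2:ℝ) else 0) = 2 := by simp
  have c3 : ∑ v : ZMod q, (if q ≤ v.val + k * q' then (2:ℝ) else 0) ≤ 2 * (k * q') := by
    rw [← Finset.sum_filter, Finset.sum_const, nsmul_eq_mul, mul_comm]
    have : (Finset.univ.filter fun v : ZMod q => q ≤ v.val + k * q').card ≤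
        (Finset.Ico (q - k * q') q).card := by
      refine Finset.card_le_card_of_injOn ZMod.val ?_ ((ZMod.val_injective q).injOn)
      intro v hv
      have hv' := (Finset.mem_filter.mp hv).2
      have := ZMod.val_lt v
      simp only [Finset.coe_Ico, Set.mem_Ico]
      omega
    rw [Nat.card_Ico] at this
    have h3 : (Finset.univ.filter fun v : ZMod q => q ≤ v.val + k * q').card ≤ k * q' := by omega
    have h4 : ((Finset.univ.filter fun v : ZMod q => q ≤ v.val + k * q').card : ℝ) ≤ k * q' := by
      exact_mod_cast h3
    linarith
  linarith

theorem avg_bound (q N : ℕ) [hq : Fact q.Prime] (h : ℕ → ℝ) (m B e : ℝ) (hB : 0 < B)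
    (hh : ∀ a, |h a| ≤ B) (hm : |m| ≤ B) (he : 0 ≤ e)
    (hper : ∀ p < N, |h p - h (p % q)| ≤ e) :
    |∑ p ∈ (Finset.range N).filter Nat.Prime, h p -
        ((Finset.range N).filter Nat.Prime).card * m| ≤
      2 * B * |∑ p ∈ (Finset.range N).filter Nat.Prime, resFun q h m B p| +
        e * ((Finset.range N).filter Nat.Prime).card + 2 * B := by
  set P := (Finset.range N).filter Nat.Prime with hP
  have hpt : ∀ p ∈ P, |h p - m - 2 * B * resFun q h m B p| ≤ e + if p = q then 2 * B else 0 := by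
    intro p hp
    obtain ⟨hpN, hpp⟩ := Finset.mem_filter.mp hp
    have hpN := Finset.mem_range.mp hpN
    by_cases h0 : p = q
    · rw [if_pos h0]
      have : resFun q h m B p = 0 := by simp [resFun, h0]
      rw [this, mul_zero, sub_zero]
      have := abs_sub (h p) m
      linarith [hh p]
    · rw [if_neg h0, add_zero]
      have hne : (p : ZMod q) ≠ 0 := by
        rw [Ne, ZMod.natCast_eq_zero_iff]
        intro hd
        exact h0 ((Nat.prime_dvd_prime_iff_eq hq.out hpp).mp hd).symm
      simp only [resFun, if_neg hne, ZMod.val_natCast]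
      rw [mul_div_cancel₀ _ (by positivity), sub_sub_sub_cancel_right]
      exact hper p hpN
  have e1 : ∑ p ∈ P, h p - P.card * m = 2 * B * ∑ p ∈ P, resFun q h m B p +
      ∑ p ∈ P, (h p - m - 2 * B * resFun q h m B p) := by
    rw [Finset.sum_sub_distrib, Finset.sum_sub_distrib, Finset.mul_sum, Finset.sum_const,
      nsmul_eq_mul]
    ring
  have e2 : |∑ p ∈ P, (h p - m - 2 * B * resFun q h m B p)| ≤ e * P.card + 2 * B := by
    refine (Finset.abs_sum_le_sum_abs _ _).trans ((Finset.sum_le_sum hpt).trans ?_)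
    rw [Finset.sum_add_distrib, Finset.sum_const, nsmul_eq_mul, Finset.sum_ite_eq', mul_comm]
    split_ifs <;> linarith
  rw [e1]
  refine (abs_add_le _ _).trans ?_
  rw [abs_mul, abs_of_pos (by positivity : 0 < 2 * B)]
  linarith

theorem mean_close (q : ℕ) [hq : Fact q.Prime] (h : ℕ → ℝ) (B : ℝ) (hB : 0 < B)
    (hh : ∀ a, |h a| ≤ B) : ∃ m : ℝ, |m| ≤ B ∧ ∑ v : ZMod q, resFun q h m B v = 0 ∧
      |m - (1 / (q:ℝ)) * ∑ a ∈ Finset.range q, h a| ≤ 2 * B / (q - 1) := by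
  have hq2 : (2:ℝ) ≤ q := by exact_mod_cast hq.out.two_le
  have hq1 : (0:ℝ) < q - 1 := by linarith
  set T := ∑ v ∈ Finset.univ.erase (0 : ZMod q), h v.val with hT
  have hcard : ((Finset.univ.erase (0 : ZMod q)).card : ℝ) = q - 1 := by
    rw [Finset.card_erase_of_mem (Finset.mem_univ _), Finset.card_univ, ZMod.card,
      Nat.cast_sub hq.out.one_le]; simp
  have hTs : T + h 0 = ∑ a ∈ Finset.range q, h a := by
    have e1 := Finset.sum_erase_add (s := Finset.univ) (fun v : ZMod q => h v.val)
      (Finset.mem_univ 0)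
    simp only [ZMod.val_zero] at e1
    rw [hT, e1]
    refine Finset.sum_bij (fun v _ => v.val) ?_ ?_ ?_ ?_
    · intro v _; exact Finset.mem_range.mpr (ZMod.val_lt v)
    · intro v _ w _ hvw; exact ZMod.val_injective q hvw
    · intro a ha
      exact ⟨(a : ZMod q), Finset.mem_univ _, ZMod.val_cast_of_lt (Finset.mem_range.mp ha)⟩
    · intro _ _; rfl
  refine ⟨T / (q - 1), ?_, ?_, ?_⟩
  · rw [abs_div, abs_of_pos hq1, div_le_iff₀ hq1, ← hcard]
    refine (Finset.abs_sum_le_sum_abs _ _).trans ((Finset.sum_le_sum fun v _ => hh v.val).trans ?_)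
    rw [Finset.sum_const, nsmul_eq_mul, mul_comm]
  · rw [← Finset.sum_erase_add (s := Finset.univ) _ (Finset.mem_univ (0 : ZMod q))]
    have e0 : resFun q h (T / (q - 1)) B 0 = 0 := by simp [resFun]
    rw [e0, add_zero]
    have e1 : ∀ v ∈ Finset.univ.erase (0 : ZMod q), resFun q h (T / (q - 1)) B v =
        (h v.val - T / (q - 1)) / (2 * B) := fun v hv => by
      simp [resFun, Finset.ne_of_mem_erase hv]
    rw [Finset.sum_congr rfl e1, ← Finset.sum_div, Finset.sum_sub_distrib, Finset.sum_const,
      nsmul_eq_mul, hcard, ← hT]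
    have : ((q:ℝ) - 1) * (T / (q - 1)) = T := by field_simp
    rw [this]; simp
  · have hS : |∑ a ∈ Finset.range q, h a| ≤ q * B := by
      refine (Finset.abs_sum_le_sum_abs _ _).trans ((Finset.sum_le_sum fun a _ => hh a).trans ?_)
      simp
    rw [← hTs] at hS ⊢
    have e1 : T / (q - 1) - 1 / q * (T + h 0) = ((1 / q) * (T + h 0) - h 0) / (q - 1) := by
      field_simp; ring
    rw [e1, abs_div, abs_of_pos hq1]
    gcongr
    refine (abs_sub _ _).trans ?_
    have : |1 / (q:ℝ) * (T + h 0)| ≤ B := by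
      rw [abs_mul, abs_of_pos (by positivity), one_div, inv_mul_le_iff₀ (by linarith)]
      exact hS
    linarith [hh 0]


theorem exp_grow (c₀ δ A : ℝ) (hc₀ : 0 < c₀) (hδ : 0 < δ) (hA : 0 ≤ A) :
    ∃ T : ℝ, ∀ t : ℝ, T ≤ t → A * (t + 1) ≤ c₀ * Real.exp (δ * t) := by
  refine ⟨1 + 4 * A / (c₀ * δ ^ 2), fun t ht => ?_⟩
  have h0 : 0 ≤ 4 * A / (c₀ * δ ^ 2) := by positivity
  have ht1 : 1 ≤ t := by linarith
  have h1 : 4 * A ≤ c₀ * δ ^ 2 * t := by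
    rw [← div_le_iff₀' (by positivity)]; linarith
  have h2 := Real.pow_div_factorial_le_exp (δ * t) (by positivity) 2
  have h3 : (Nat.factorial 2 : ℝ) = 2 := by norm_num [Nat.factorial]
  rw [h3] at h2
  calc A * (t + 1) ≤ A * (2 * t) := by gcongr; linarith
    _ = (4 * A) * t / 2 := by ring
    _ ≤ (c₀ * δ ^ 2 * t) * t / 2 := by gcongr
    _ = c₀ * ((δ * t) ^ 2 / 2) := by ring
    _ ≤ _ := by gcongr

theorem unbounded_case {X : Type*} [MetricSpace X] [CompactSpace X] [MeasurableSpace X]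
    (φ : ℝ → X → X)
    (hφadd : ∀ s t : ℝ, ∀ x : X, φ (s + t) x = φ s (φ t x))
    (ν : MeasureTheory.Measure X)
    (huniq : ∀ x : X, ∀ g : X → ℝ, Continuous g →
      Filter.Tendsto (fun N : ℕ => (1 / (N : ℝ)) * ∑ a ∈ Finset.range N, g (φ (a : ℝ) x))
        Filter.atTop (nhds (∫ y, g y ∂ν)))
    (q : ℕ → ℕ) (hqp : ∀ n, (q n).Prime)
    (c₀ δ : ℝ) (hc₀ : 0 < c₀) (hδ : 0 < δ)
    (hgrow : ∀ n : ℕ, (q (n + 1) : ℝ) ≥ c₀ * Real.exp (δ * (q n : ℝ)))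
    (d : ℝ) (hd : 0 < d)
    (hclose : ∀ ε > (0 : ℝ), ∃ N : ℕ, ∀ n ≥ N, ∀ x : X,
      ∀ K : ℕ, K ≤ ⌈Real.exp (d * (q n : ℝ))⌉₊ →
        dist (φ ((K * q n : ℕ) : ℝ) x) x < ε)
    (hqT : Filter.Tendsto q Filter.atTop Filter.atTop) :
    ∀ x : X, ∀ g : X → ℝ, Continuous g →
      Filter.Tendsto (fun n : ℕ =>
          (1 / (((Finset.range (⌈Real.exp (d * (q n : ℝ))⌉₊ * q n)).filter
              Nat.Prime).card : ℝ)) *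
            ∑ p ∈ (Finset.range (⌈Real.exp (d * (q n : ℝ))⌉₊ * q n)).filter Nat.Prime,
              g (φ (p : ℝ) x))
        Filter.atTop (nhds (∫ y, g y ∂ν)) := by
  intro x g hg
  rw [← Filter.tendsto_add_atTop_iff_nat 1]
  rw [Metric.tendsto_nhds]
  intro ε hε
  obtain ⟨B, hB, hgB⟩ : ∃ B : ℝ, 0 < B ∧ ∀ y, |g y| ≤ B := by
    obtain ⟨C, hC⟩ := isCompact_univ.exists_bound_of_continuousOn hg.continuousOn
    exact ⟨|C| + 1, by positivity, fun y => by
      have := hC y (Set.mem_univ y)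
      rw [Real.norm_eq_abs] at this
      linarith [le_abs_self C]⟩
  have hunif := Metric.uniformContinuous_iff.mp (CompactSpace.uniformContinuous_of_continuous hg)
  set h : ℕ → ℝ := fun a => g (φ (a : ℝ) x) with hh
  have hhB : ∀ a, |h a| ≤ B := fun a => hgB _
  have hflow : ∀ k Q a : ℕ, φ ((a + k * Q : ℕ) : ℝ) x = φ ((k * Q : ℕ) : ℝ) (φ (a : ℝ) x) := by
    intro k Q a
    rw [← hφadd]; congr 1; push_cast; ring
  obtain ⟨K, hK0, τ, hτ0, Q0, hnt⟩ := nt_main (ε / (16 * B)) d (by positivity) hd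
  obtain ⟨ρ1, hρ1, hu1⟩ := hunif (ε / 8) (by positivity)
  obtain ⟨ρ2, hρ2, hu2⟩ := hunif (2 * B * (τ / 2)) (by positivity)
  obtain ⟨N1, hN1⟩ := hclose ρ1 hρ1
  obtain ⟨N2, hN2⟩ := hclose ρ2 hρ2
  obtain ⟨T, hT⟩ := exp_grow c₀ δ (1 + (2 + 2 * K) * (2 / τ)) hc₀ hδ (by positivity)
  have hqR : Filter.Tendsto (fun n => (q n : ℝ)) Filter.atTop Filter.atTop :=
    tendsto_natCast_atTop_atTop.comp hqT
  have hq1T : Filter.Tendsto (fun n => q (n + 1)) Filter.atTop Filter.atTop :=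
    (Filter.tendsto_add_atTop_iff_nat 1).mpr hqT
  have hq1R : Filter.Tendsto (fun n => (q (n + 1) : ℝ)) Filter.atTop Filter.atTop :=
    tendsto_natCast_atTop_atTop.comp hq1T
  have hpc : Filter.Tendsto (fun n : ℕ => (Nat.primeCounting' n : ℝ)) Filter.atTop Filter.atTop :=
    tendsto_natCast_atTop_atTop.comp Nat.tendsto_primeCounting'
  have ev5 := (hpc.comp hq1T).eventually_ge_atTop (16 * B / ε)
  have ev6 := (Metric.tendsto_nhds.mp ((huniq x g hg).comp hq1T)) (ε / 8) (by positivity)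
  filter_upwards [Filter.eventually_ge_atTop N1, Filter.eventually_ge_atTop N2,
    hqR.eventually_ge_atTop T, hq1R.eventually_ge_atTop Q0,
    hqR.eventually_ge_atTop (K / d), ev5, ev6,
    hq1R.eventually_ge_atTop (16 * B / ε + 1)] with n g1 g2 g3 g4 g5 g6 g7 g8
  have : Fact (q (n + 1)).Prime := ⟨hqp _⟩
  have hq2 : 2 ≤ q (n + 1) := (hqp _).two_le
  set Q := q (n + 1) with hQ
  set Q' := q n with hQ'
  set KN := ⌈Real.exp (d * (Q : ℝ))⌉₊ with hKN
  have hKN1 : Real.exp (d * Q) ≤ KN := Nat.le_ceil _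
  have hKN0 : 0 < KN := by
    have : (0:ℝ) < KN := lt_of_lt_of_le (Real.exp_pos _) hKN1
    exact_mod_cast this
  have hQQ : (1 + (2 + 2 * K) * (2 / τ)) * ((Q':ℝ) + 1) ≤ Q := (hT _ g3).trans (hgrow n)
  have hKR : (0:ℝ) < K := by exact_mod_cast hK0
  have hQ'0 : (0:ℝ) ≤ Q' := Nat.cast_nonneg _
  have hlt : Q' < Q := by
    have : (Q':ℝ) < Q := by
      have h1 : 0 ≤ ((2 + 2 * K) * (2 / τ)) * ((Q':ℝ) + 1) := by positivity
      linarith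
    exact_mod_cast this
  have hKle : K ≤ ⌈Real.exp (d * (Q' : ℝ))⌉₊ := by
    have h1 : (K:ℝ) ≤ d * Q' := by rwa [div_le_iff₀' hd] at g5
    have h2 := Real.add_one_le_exp (d * (Q':ℝ))
    have h3 : (K:ℝ) ≤ ⌈Real.exp (d * (Q' : ℝ))⌉₊ :=
      le_trans (by linarith) (Nat.le_ceil _)
    exact_mod_cast h3
  obtain ⟨m, hmB, hm0, hmc⟩ := mean_close Q h B hB hhB
  -- shift
  have hshift : ∀ k < K, ∑ v : ZMod Q, |resFun Q h m B (v + k * (Q' : ZMod Q)) -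
      resFun Q h m B v| ≤ τ * Q := by
    intro k hk
    refine (shift_bound Q Q' k h m B (τ / 2) hB hhB hmB (by positivity) ?_).trans ?_
    · intro a
      have hdist := hN2 n g2 (φ (a : ℝ) x) k (hk.le.trans hKle)
      have := hu2 hdist
      rw [← hflow, Real.dist_eq] at this
      exact this.le
    · have hkR : (k:ℝ) ≤ K := by exact_mod_cast hk.le
      have h1 : (2 + 2 * K) * ((Q':ℝ) + 1) ≤ τ / 2 * Q := by
        have h2 : ((2 + 2 * K) * (2 / τ)) * ((Q':ℝ) + 1) ≤ Q := by linarith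
        calc (2 + 2 * K) * ((Q':ℝ) + 1) = τ / 2 * (((2 + 2 * K) * (2 / τ)) * ((Q':ℝ) + 1)) := by
              field_simp
          _ ≤ _ := by gcongr
      have h3 : (k:ℝ) * Q' ≤ K * Q' := by gcongr
      nlinarith
  have hs : (Q' : ZMod Q) ≠ 0 := by
    rw [Ne, ZMod.natCast_eq_zero_iff]
    intro hdv
    have := Nat.le_of_dvd (hqp n).pos hdv
    omega
  set N := KN * Q with hN
  have hN2' : KN + 1 ≤ N := by
    have : KN * 2 ≤ KN * Q := Nat.mul_le_mul_left _ hq2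
    omega
  have hXl : d * Q ≤ Real.log ((N - 1 : ℕ) : ℝ) := by
    have h1 : (KN : ℝ) ≤ (N - 1 : ℕ) := by
      have : KN ≤ N - 1 := by omega
      exact_mod_cast this
    rw [Real.le_log_iff_exp_le (lt_of_lt_of_le (by exact_mod_cast hKN0) h1)]
    linarith
  have hf0 : resFun Q h m B 0 = 0 := by simp [resFun]
  have hmain := hnt Q g4 (resFun Q h m B) (Q' : ZMod Q) (N - 1) hf0 hm0
    (resFun_abs Q h m B hB hhB hmB) hs hshift hXl
  rw [Nat.sub_add_cancel (by omega)] at hmain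
  have havg := avg_bound Q N h m B (ε / 8) hB hhB hmB (by positivity) ?_
  swap
  · intro p hp
    have hk : p / Q ≤ KN := by
      have : p / Q < KN := (Nat.div_lt_iff_lt_mul (by omega)).mpr hp
      omega
    have hdist := hN1 (n + 1) (by omega) (φ ((p % Q : ℕ) : ℝ) x) (p / Q) hk
    have := hu1 hdist
    rw [← hflow, Real.dist_eq, Nat.mod_add_div'] at this
    exact this.le
  set P := (Finset.range N).filter Nat.Prime with hP
  have hPc : 16 * B / ε ≤ P.card := by
    refine le_trans g6 ?_
    have h1 : Nat.primeCounting' Q ≤ Nat.primeCounting' N :=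
      Nat.monotone_primeCounting' (Nat.le_mul_of_pos_left _ hKN0)
    have h2 : Nat.primeCounting' N = P.card := by
      rw [Nat.primeCounting', Nat.count_eq_card_filter_range]
    rw [h2] at h1
    change (Nat.primeCounting' Q : ℝ) ≤ P.card
    exact_mod_cast h1
  have hPpos : (0:ℝ) < P.card := lt_of_lt_of_le (by positivity) hPc
  have hPB : 2 * B ≤ ε / 8 * P.card := by
    rw [div_le_iff₀ hε] at hPc; linarith
  have hfin : |∑ p ∈ P, h p - P.card * m| ≤ 3 * (ε / 8) * P.card := by
    have : 2 * B * |∑ p ∈ P, resFun Q h m B p| ≤ ε / 8 * P.card := by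
      calc _ ≤ 2 * B * (ε / (16 * B) * P.card) := by gcongr
        _ = _ := by field_simp; norm_num
    linarith
  have hfin2 : |1 / (P.card : ℝ) * ∑ p ∈ P, h p - m| ≤ 3 * (ε / 8) := by
    have e1 : 1 / (P.card : ℝ) * ∑ p ∈ P, h p - m = (∑ p ∈ P, h p - P.card * m) / P.card := by
      field_simp
    rw [e1, abs_div, abs_of_pos hPpos, div_le_iff₀ hPpos]
    exact hfin
  have hQ8 : 2 * B / ((Q:ℝ) - 1) ≤ ε / 8 := by
    have h1 : 16 * B / ε ≤ (Q:ℝ) - 1 := by linarith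
    have h2 : (0:ℝ) < (Q:ℝ) - 1 := lt_of_lt_of_le (by positivity) h1
    rw [div_le_iff₀ hε] at h1
    rw [div_le_iff₀ h2]; linarith
  simp only [Function.comp, Real.dist_eq] at g7
  rw [Real.dist_eq]
  change |1 / (P.card : ℝ) * ∑ p ∈ P, h p - _| < ε
  change |1 / (Q : ℝ) * ∑ a ∈ Finset.range Q, h a - _| < ε / 8 at g7
  have hm8 := hmc.trans hQ8
  rw [abs_lt] at *
  rw [abs_le] at hm8 hfin2
  constructor <;> linarith [hm8.1, hm8.2, hfin2.1, hfin2.2, g7.1, g7.2]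

theorem bounded_case {X : Type*} [MetricSpace X] [MeasurableSpace X]
    (φ : ℝ → X → X)
    (hφcont : Continuous fun p : ℝ × X => φ p.1 p.2)
    (hφ0 : ∀ x : X, φ 0 x = x)
    (hφadd : ∀ s t : ℝ, ∀ x : X, φ (s + t) x = φ s (φ t x))
    (ν : MeasureTheory.Measure X)
    (huniq : ∀ x : X, ∀ g : X → ℝ, Continuous g →
      Filter.Tendsto (fun N : ℕ => (1 / (N : ℝ)) * ∑ a ∈ Finset.range N, g (φ (a : ℝ) x))
        Filter.atTop (nhds (∫ y, g y ∂ν)))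
    (v : ℕ) (hv : 0 < v) (hper : ∀ x, φ (v : ℝ) x = x) (x : X) (g : X → ℝ) (hg : Continuous g) :
    (∀ t, φ t x = x) ∧ ∫ y, g y ∂ν = g x := by
  have hvR : (0:ℝ) < v := by exact_mod_cast hv
  have hint : ∀ y, ∀ g : X → ℝ, Continuous g →
      ∫ z, g z ∂ν = (1 / (v:ℝ)) * ∑ a ∈ Finset.range v, g (φ (a : ℝ) y) := by
    intro y g hg
    have hs : ∀ M : ℕ, ∑ a ∈ Finset.range (v * M), g (φ (a : ℝ) y) =
        M * ∑ a ∈ Finset.range v, g (φ (a : ℝ) y) := by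
      have hp1 : ∀ a : ℝ, φ (a + v) y = φ a y := fun a => by rw [hφadd, hper]
      have hp : ∀ M a : ℕ, φ ((v * M + a : ℕ) : ℝ) y = φ (a : ℝ) y := by
        intro M a
        induction M with
        | zero => simp
        | succ M ih =>
          rw [← ih, ← hp1 ((v * M + a : ℕ) : ℝ)]; congr 1; push_cast; ring
      intro M
      induction M with
      | zero => simp
      | succ M ih =>
        rw [Nat.mul_succ, Finset.sum_range_add, ih]
        simp_rw [hp]
        push_cast; ring
    have h1 : Filter.Tendsto (fun M : ℕ => v * (M + 1)) Filter.atTop Filter.atTop :=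
      Filter.tendsto_atTop_mono (fun M => by
        have := Nat.le_mul_of_pos_left (M + 1) hv
        exact (Nat.le_succ M).trans this) Filter.tendsto_id
    have h2 := (huniq y g hg).comp h1
    refine tendsto_nhds_unique h2 ?_
    refine tendsto_const_nhds.congr fun M => ?_
    simp only [Function.comp]
    rw [hs]
    push_cast
    field_simp
  -- the space is finite
  set S : Set X := (fun a : ℕ => φ (a : ℝ) x) '' (Finset.range v : Set ℕ) with hS
  have hSf : S.Finite := (Finset.finite_toSet _).image _
  have hxS : x ∈ S := ⟨0, by simpa using hv, by simp [hφ0]⟩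
  have hc : Continuous fun y => Metric.infDist y S := Metric.continuous_infDist_pt S
  have hz : ∑ a ∈ Finset.range v, Metric.infDist (φ (a : ℝ) x) S = 0 :=
    Finset.sum_eq_zero fun a ha => Metric.infDist_zero_of_mem ⟨a, ha, rfl⟩
  have hall : ∀ y, y ∈ S := by
    intro y
    have h1 := (hint x _ hc).symm.trans (hint y _ hc)
    rw [hz, mul_zero] at h1
    have h2 : ∑ a ∈ Finset.range v, Metric.infDist (φ (a : ℝ) y) S = 0 := by
      rcases mul_eq_zero.mp h1.symm with h | h
      · exact absurd h (by positivity)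
      · exact h
    have h3 := (Finset.sum_eq_zero_iff_of_nonneg fun a _ => Metric.infDist_nonneg).mp h2 0
      (Finset.mem_range.mpr hv)
    simp only [Nat.cast_zero, hφ0] at h3
    exact (hSf.isClosed.mem_iff_infDist_zero ⟨x, hxS⟩).mpr h3
  have : Finite X := Set.finite_univ_iff.mp (hSf.subset fun y _ => hall y)
  have hconst : ∀ t, φ t x = x := by
    intro t
    have hcx : Continuous fun t : ℝ => φ t x := hφcont.comp (by fun_prop : Continuous fun t : ℝ => (t, x))
    have := PreconnectedSpace.constant (inferInstance : PreconnectedSpace ℝ) hcx (x := t) (y := 0)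
    simpa [hφ0] using this
  refine ⟨hconst, ?_⟩
  rw [hint x g hg]
  simp only [hconst]
  simp only [Finset.sum_const, Finset.card_range, nsmul_eq_mul]
  field_simp

open Finset MeasureTheory in
/-- Abstract prime-orbit equidistribution: for a uniquely ergodic continuous flow `φ` on a
compact metric space whose time-`K·qₙ` maps are uniformly close to the identity for
`0 ≤ K ≤ Kₙ = ⌈e^{d·qₙ}⌉`, orbits sampled at primes below `Nₙ = Kₙ·qₙ` equidistribute
with respect to the invariant measure `ν`. -/
theorem stmt_11 {X : Type*} [MetricSpace X] [CompactSpace X] [MeasurableSpace X] [BorelSpace X]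
    (φ : ℝ → X → X)
    (hφcont : Continuous fun p : ℝ × X => φ p.1 p.2)
    (hφ0 : ∀ x : X, φ 0 x = x)
    (hφadd : ∀ s t : ℝ, ∀ x : X, φ (s + t) x = φ s (φ t x))
    (ν : Measure X) [IsProbabilityMeasure ν]
    (huniq : ∀ x : X, ∀ g : X → ℝ, Continuous g →
      Filter.Tendsto (fun N : ℕ => (1 / (N : ℝ)) * ∑ a ∈ Finset.range N, g (φ (a : ℝ) x))
        Filter.atTop (nhds (∫ y, g y ∂ν)))
    (q : ℕ → ℕ) (hqp : ∀ n, (q n).Prime)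
    (c₀ δ : ℝ) (hc₀ : 0 < c₀) (hδ : 0 < δ)
    (hgrow : ∀ n : ℕ, (q (n + 1) : ℝ) ≥ c₀ * Real.exp (δ * (q n : ℝ)))
    (d : ℝ) (hd : 0 < d) (hdδ : d < δ)
    (hclose : ∀ ε > (0 : ℝ), ∃ N : ℕ, ∀ n ≥ N, ∀ x : X,
      ∀ K : ℕ, K ≤ ⌈Real.exp (d * (q n : ℝ))⌉₊ →
        dist (φ ((K * q n : ℕ) : ℝ) x) x < ε) :
    ∀ x : X, ∀ g : X → ℝ, Continuous g →
      Filter.Tendsto (fun n : ℕ =>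
          (1 / (((Finset.range (⌈Real.exp (d * (q n : ℝ))⌉₊ * q n)).filter
              Nat.Prime).card : ℝ)) *
            ∑ p ∈ (Finset.range (⌈Real.exp (d * (q n : ℝ))⌉₊ * q n)).filter Nat.Prime,
              g (φ (p : ℝ) x))
        Filter.atTop (nhds (∫ y, g y ∂ν)) := by
  by_cases hqT : Filter.Tendsto q Filter.atTop Filter.atTop
  · exact unbounded_case φ hφadd ν huniq q hqp c₀ δ hc₀ hδ hgrow d hd hclose hqT
  obtain ⟨T, hT⟩ := exp_grow c₀ δ 1 hc₀ hδ zero_le_one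
  have hbd : ∀ n, (q n : ℝ) < T := by
    by_contra hcon
    push Not at hcon
    obtain ⟨n0, hn0⟩ := hcon
    apply hqT
    have hstep : ∀ k, T ≤ (q (n0 + k) : ℝ) ∧ k ≤ q (n0 + k) := by
      intro k
      induction k with
      | zero => exact ⟨hn0, Nat.zero_le _⟩
      | succ k ih =>
        have h1 := (hT _ ih.1).trans (hgrow (n0 + k))
        have h2 : q (n0 + k) + 1 ≤ q (n0 + k + 1) := by
          rw [one_mul] at h1
          exact_mod_cast h1
        refine ⟨by rw [one_mul] at h1; rw [← add_assoc]; linarith [ih.1], ?_⟩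
        rw [← add_assoc]; omega
    rw [← Filter.tendsto_add_atTop_iff_nat n0]
    refine Filter.tendsto_atTop_mono (fun k => ?_) Filter.tendsto_id
    rw [add_comm]; exact (hstep k).2
  have hfreq : ∃ v : ℕ, ∃ᶠ n in Filter.atTop, q n = v := by
    by_contra hcon
    push Not at hcon
    have hcon' : ∀ v : ℕ, ∀ᶠ n in Filter.atTop, q n ≠ v := by
      intro v
      have := hcon v
      simpa [Filter.not_frequently] using this
    have h2 : ∀ᶠ n in Filter.atTop, ∀ v ∈ Finset.range ⌈T⌉₊, q n ≠ v :=
      (Filter.eventually_all_finset _).mpr fun v _ => hcon' v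
    obtain ⟨n, hn⟩ := h2.exists
    refine hn (q n) (Finset.mem_range.mpr ?_) rfl
    exact Nat.lt_ceil.mpr (hbd n)
  obtain ⟨v, hv⟩ := hfreq
  have hv0 : 0 < v := by
    obtain ⟨n, hn⟩ := hv.exists
    rw [← hn]; exact (hqp n).pos
  have hper : ∀ x, φ (v : ℝ) x = x := by
    intro x
    refine eq_of_forall_dist_le fun ε hε => ?_
    obtain ⟨N, hN⟩ := hclose ε hε
    obtain ⟨n, hn, hnv⟩ := (Filter.frequently_atTop.mp hv) N
    have := hN n hn x 1 (Nat.one_le_ceil_iff.mpr (Real.exp_pos _))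
    rw [one_mul, hnv] at this
    exact this.le
  intro x g hg
  obtain ⟨hc, hi⟩ := bounded_case φ hφcont hφ0 hφadd ν huniq v hv0 hper x g hg
  rw [hi]
  refine tendsto_const_nhds.congr fun n => ?_
  simp only [hc, Finset.sum_const, nsmul_eq_mul]
  have hK2 : 1 < ⌈Real.exp (d * (q n : ℝ))⌉₊ := by
    rw [Nat.lt_ceil]
    have := (hqp n).pos
    simp only [Nat.cast_one, Real.one_lt_exp_iff]
    positivity
  have hcard : 0 < ((Finset.range (⌈Real.exp (d * (q n : ℝ))⌉₊ * q n)).filter Nat.Prime).card := by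
    rw [Finset.card_pos]
    refine ⟨2, Finset.mem_filter.mpr ⟨Finset.mem_range.mpr ?_, Nat.prime_two⟩⟩
    have := (hqp n).two_le
    nlinarith
  have hcard' : (((Finset.range (⌈Real.exp (d * (q n : ℝ))⌉₊ * q n)).filter Nat.Prime).card : ℝ)
      ≠ 0 := by exact_mod_cast hcard.ne'
  field_simp
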